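/- Let G be a finite group and N a solvable normal subgroup of G with |cd(G|N)| = 2. Then the derived length of N is at most 2, i.e., N is metabelian. -/

import Mathlib

open CategoryTheory

/-- `cdOver G N` is `cd(G|N)`: the set of degrees `χ(1)` of irreducible complex characters
`χ` of `G` whose kernel does not contain `N`. -/
def cdOver (G : Type) [Group G] (N : Subgroup G) : Set ℕ :=
  { d | ∃ V : FDRep ℂ G, Simple V ∧ (¬ ∀ n ∈ N, V.character n = V.character 1) ∧
        d = Module.finrank ℂ V }

open scoped commutatorElement

namespace CRep

section Basic

variable {G : Type} [Group G] {V W U : Type} [AddCommGroup V] [Module ℂ V]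
  [AddCommGroup W] [Module ℂ W] [AddCommGroup U] [Module ℂ U]

/-- Invariant subspaces of a representation. -/
def IsInv (ρ : Representation ℂ G V) (W : Submodule ℂ V) : Prop := ∀ g, ∀ w ∈ W, ρ g w ∈ W

/-- Irreducible representations. -/
def IsIrr (ρ : Representation ℂ G V) : Prop :=
  Nontrivial V ∧ ∀ W, IsInv ρ W → W = ⊥ ∨ W = ⊤

/-- The restriction of a representation to an invariant subspace. -/
def subRep (ρ : Representation ℂ G V) (W : Submodule ℂ V) (h : IsInv ρ W) :
    Representation ℂ G W where
  toFun g := (ρ g).restrict (h g)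
  map_one' := by ext; simp
  map_mul' a b := by ext; simp

@[simp] lemma subRep_coe (ρ : Representation ℂ G V) (W : Submodule ℂ V) (h : IsInv ρ W) (g : G)
    (w : W) : ((subRep ρ W h g w : W) : V) = ρ g w := rfl

/-- Equivariant linear maps. -/
def IsEquiv (ρ : Representation ℂ G V) (σ : Representation ℂ G W) (f : V →ₗ[ℂ] W) : Prop :=
  ∀ g v, f (ρ g v) = σ g (f v)

/-- Minimal nonzero invariant subspaces. -/
def IsIrrSub (ρ : Representation ℂ G V) (U : Submodule ℂ V) : Prop :=
  IsInv ρ U ∧ U ≠ ⊥ ∧ ∀ U' ≤ U, IsInv ρ U' → U' = ⊥ ∨ U' = U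

lemma subtype_isEquiv (ρ : Representation ℂ G V) (W : Submodule ℂ V) (h : IsInv ρ W) :
    IsEquiv (subRep ρ W h) ρ W.subtype := fun _ _ => rfl

lemma rho_inv_self (ρ : Representation ℂ G V) (g : G) (v : V) : ρ g⁻¹ (ρ g v) = v := by
  rw [← Module.End.mul_apply, ← map_mul]; simp

lemma rho_self_inv (ρ : Representation ℂ G V) (g : G) (v : V) : ρ g (ρ g⁻¹ v) = v := by
  rw [← Module.End.mul_apply, ← map_mul]; simp

lemma IsInv.inf {ρ : Representation ℂ G V} {A B : Submodule ℂ V} (hA : IsInv ρ A)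
    (hB : IsInv ρ B) : IsInv ρ (A ⊓ B) := fun g w hw => ⟨hA g w hw.1, hB g w hw.2⟩

lemma isInv_top (ρ : Representation ℂ G V) : IsInv ρ ⊤ := fun _ _ _ => trivial

lemma IsEquiv.comp {ρ : Representation ℂ G V} {σ : Representation ℂ G W}
    {τ : Representation ℂ G U} {f : V →ₗ[ℂ] W} {g : W →ₗ[ℂ] U} (hg : IsEquiv σ τ g)
    (hf : IsEquiv ρ σ f) : IsEquiv ρ τ (g ∘ₗ f) := fun x v => by simp [hf x v, hg x (f v)]

lemma IsEquiv.isInv_ker {ρ : Representation ℂ G V} {σ : Representation ℂ G W}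
    {f : V →ₗ[ℂ] W} (hf : IsEquiv ρ σ f) : IsInv ρ (LinearMap.ker f) := fun g v hv => by
  rw [LinearMap.mem_ker] at *; rw [hf, hv, map_zero]

lemma IsEquiv.isInv_map {ρ : Representation ℂ G V} {σ : Representation ℂ G W}
    {f : V →ₗ[ℂ] W} (hf : IsEquiv ρ σ f) {A : Submodule ℂ V} (hA : IsInv ρ A) :
    IsInv σ (A.map f) := by
  rintro g _ ⟨v, hv, rfl⟩
  exact ⟨ρ g v, hA g v hv, hf g v⟩

lemma IsEquiv.isInv_range {ρ : Representation ℂ G V} {σ : Representation ℂ G W}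
    {f : V →ₗ[ℂ] W} (hf : IsEquiv ρ σ f) : IsInv σ (LinearMap.range f) := by
  rw [LinearMap.range_eq_map]; exact hf.isInv_map (isInv_top ρ)

lemma IsEquiv.restrict {ρ : Representation ℂ G V} {σ : Representation ℂ G W}
    {f : V →ₗ[ℂ] W} (hf : IsEquiv ρ σ f) (H : Subgroup G) :
    IsEquiv (ρ.comp H.subtype) (σ.comp H.subtype) f := fun x v => hf x v

lemma IsIrr.injective {ρ : Representation ℂ G V} (h : IsIrr ρ) {σ : Representation ℂ G W}
    {f : V →ₗ[ℂ] W} (hf : IsEquiv ρ σ f) (h0 : f ≠ 0) : Function.Injective f := by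
  rw [← LinearMap.ker_eq_bot]
  refine (h.2 _ hf.isInv_ker).resolve_right fun h1 => h0 (LinearMap.ker_eq_top.1 h1)

lemma IsIrr.surjective {ρ : Representation ℂ G V} {σ : Representation ℂ G W} (h : IsIrr σ)
    {f : V →ₗ[ℂ] W} (hf : IsEquiv ρ σ f) (h0 : f ≠ 0) : Function.Surjective f := by
  rw [← LinearMap.range_eq_top]
  refine (h.2 _ hf.isInv_range).resolve_left fun h1 => h0 (LinearMap.range_eq_bot.1 h1)

lemma IsIrrSub.isIrr {ρ : Representation ℂ G V} {A : Submodule ℂ V} (h : IsIrrSub ρ A) :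
    IsIrr (subRep ρ A h.1) := by
  refine ⟨(Submodule.nontrivial_iff_ne_bot).2 h.2.1, fun B hB => ?_⟩
  have := h.2.2 (B.map A.subtype) (Submodule.map_subtype_le A B)
    ((subtype_isEquiv ρ A h.1).isInv_map hB)
  rcases this with h1 | h1
  · left; exact Submodule.map_injective_of_injective A.injective_subtype (by simpa using h1)
  · right
    apply Submodule.map_injective_of_injective A.injective_subtype
    rw [h1, Submodule.map_top, Submodule.range_subtype]

lemma exists_isIrrSub {ρ : Representation ℂ G V} [FiniteDimensional ℂ V] {A : Submodule ℂ V}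
    (hA : IsInv ρ A) (h0 : A ≠ ⊥) : ∃ B ≤ A, IsIrrSub ρ B := by
  induction hn : Module.finrank ℂ A using Nat.strong_induction_on generalizing A with
  | _ n ih =>
    by_cases h : ∀ U' ≤ A, IsInv ρ U' → U' = ⊥ ∨ U' = A
    · exact ⟨A, le_rfl, hA, h0, h⟩
    · push Not at h
      obtain ⟨C, hCA, hC, hC0, hC1⟩ := h
      obtain ⟨B, hB, hB'⟩ := ih _ (hn ▸ Submodule.finrank_lt_finrank_of_lt
        (lt_of_le_of_ne hCA hC1)) hC hC0 rfl
      exact ⟨B, hB.trans hCA, hB'⟩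

/-- Averaging a linear map over the group produces an equivariant map. -/
lemma exists_average [Finite G] (ρ : Representation ℂ G V) (σ : Representation ℂ G W)
    (f : V →ₗ[ℂ] W) : ∃ F : V →ₗ[ℂ] W, IsEquiv ρ σ F ∧
      (∀ v w, (∀ g, σ g (f (ρ g⁻¹ v)) = w) → F v = w) ∧
      (∀ A : Submodule ℂ W, (∀ v, f v ∈ A) → IsInv σ A → ∀ v, F v ∈ A) := by
  cases nonempty_fintype G
  have hc : (Fintype.card G : ℂ) ≠ 0 := by exact_mod_cast Fintype.card_ne_zero
  have key : ∀ v, ((Fintype.card G : ℂ)⁻¹ • ∑ g : G, (σ g) ∘ₗ f ∘ₗ (ρ g⁻¹)) v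
      = (Fintype.card G : ℂ)⁻¹ • ∑ g : G, σ g (f (ρ g⁻¹ v)) := by
    intro v; simp [LinearMap.sum_apply]
  refine ⟨(Fintype.card G : ℂ)⁻¹ • ∑ g : G, (σ g) ∘ₗ f ∘ₗ (ρ g⁻¹), ?_, ?_, ?_⟩
  · intro x v
    rw [key, key, map_smul, map_sum]
    congr 1
    rw [← Equiv.sum_comp (Equiv.mulLeft x)]
    refine Finset.sum_congr rfl fun g _ => ?_
    simp only [Equiv.coe_mulLeft, mul_inv_rev, map_mul, Module.End.mul_apply, rho_inv_self]
  · intro v w h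
    rw [key]
    simp [h, hc, ← Nat.cast_smul_eq_nsmul ℂ, smul_smul]
  · intro A hA hA' v
    rw [key]
    exact A.smul_mem _ (A.sum_mem fun g _ => hA' g _ (hA _))

/-- Maschke's theorem. -/
lemma exists_projection [Finite G] (ρ : Representation ℂ G V) {A : Submodule ℂ V}
    (hA : IsInv ρ A) : ∃ π : V →ₗ[ℂ] A, IsEquiv ρ (subRep ρ A hA) π ∧ ∀ w : A, π w = w := by
  obtain ⟨f, hf⟩ := A.exists_isCompl
  obtain ⟨F, h1, h2, -⟩ := exists_average ρ (subRep ρ A hA) (Submodule.projectionOnto A f hf)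
  refine ⟨F, h1, fun w => h2 _ _ fun g => ?_⟩
  have : ρ g⁻¹ w = ((subRep ρ A hA g⁻¹ w : A) : V) := rfl
  rw [this, Submodule.projectionOnto_apply_left, rho_self_inv]

lemma exists_section [Finite G] {ρ : Representation ℂ G V} {σ : Representation ℂ G W}
    {f : V →ₗ[ℂ] W} (hf : IsEquiv ρ σ f) (hs : Function.Surjective f) :
    ∃ s : W →ₗ[ℂ] V, IsEquiv σ ρ s ∧ ∀ w, f (s w) = w := by
  obtain ⟨s, hs⟩ := f.exists_rightInverse_of_surjective (LinearMap.range_eq_top.2 hs)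
  have hs' : ∀ w, f (s w) = w := fun w => LinearMap.congr_fun hs w
  obtain ⟨π, hπ, hπ'⟩ := exists_projection ρ hf.isInv_ker
  let t : W →ₗ[ℂ] V := s - (LinearMap.ker f).subtype ∘ₗ π ∘ₗ s
  have ht : ∀ v, t (f v) = v - π v := by
    intro v
    have h : s (f v) - v ∈ LinearMap.ker f := by simp [LinearMap.mem_ker, hs']
    have h' := congrArg Subtype.val (hπ' ⟨_, h⟩)
    simp only [map_sub, AddSubgroupClass.coe_sub] at h'
    simp only [t, LinearMap.sub_apply, LinearMap.comp_apply, Submodule.subtype_apply]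
    rw [sub_eq_sub_iff_add_eq_add] at *
    rw [← h']
    abel
  refine ⟨t, fun g w => ?_, fun w => ?_⟩
  · have : σ g w = f (ρ g (s w)) := by rw [hf, hs']
    rw [this, ht, hπ]
    conv_rhs => rw [← hs' w, ht, map_sub]
    rfl
  · have := (π (s w)).2
    rw [LinearMap.mem_ker] at this
    simp [t, hs', this]

/-- A nonzero vector of an invariant subspace survives projection to some irreducible
constituent of this subspace. -/
lemma exists_irrSub_projection [Finite G] [FiniteDimensional ℂ V] {ρ : Representation ℂ G V}
    {A : Submodule ℂ V} (hA : IsInv ρ A) {v : V} (hv : v ∈ A) (h0 : v ≠ 0) :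
    ∃ B ≤ A, ∃ hB : IsIrrSub ρ B, ∃ π : V →ₗ[ℂ] B, IsEquiv ρ (subRep ρ B hB.1) π ∧ π v ≠ 0 := by
  induction hn : Module.finrank ℂ A using Nat.strong_induction_on generalizing A with
  | _ n ih =>
    have hA0 : A ≠ ⊥ := fun h => h0 (by simpa [h] using hv)
    obtain ⟨B, hBA, hB⟩ := exists_isIrrSub hA hA0
    obtain ⟨π, hπ, hπ'⟩ := exists_projection ρ hB.1
    by_cases hπv : π v = 0
    · have hlt : A ⊓ LinearMap.ker π < A := by
        refine lt_of_le_of_ne inf_le_left fun h => hB.2.1 ?_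
        rw [eq_bot_iff]
        intro b hb
        have : b ∈ LinearMap.ker π := (h.ge (hBA hb)).2
        have h2 := hπ' ⟨b, hb⟩
        rw [LinearMap.mem_ker] at this
        rw [this] at h2
        simpa using (congrArg Subtype.val h2).symm
      obtain ⟨C, hC, hC'⟩ := ih _ (hn ▸ Submodule.finrank_lt_finrank_of_lt hlt)
        (hA.inf hπ.isInv_ker) ⟨hv, hπv⟩ rfl
      exact ⟨C, hC.trans inf_le_left, hC'⟩
    · exact ⟨B, hBA, hB, π, hπ, hπv⟩

lemma dvd_finrank [Finite G] [FiniteDimensional ℂ V] {ρ : Representation ℂ G V}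
    {A : Submodule ℂ V} (hA : IsInv ρ A) {m : ℕ}
    (h : ∀ B ≤ A, IsIrrSub ρ B → m ∣ Module.finrank ℂ B) : m ∣ Module.finrank ℂ A := by
  induction hn : Module.finrank ℂ A using Nat.strong_induction_on generalizing A with
  | _ n ih =>
    subst hn
    by_cases hA0 : A = ⊥
    · subst hA0; simp
    obtain ⟨B, hBA, hB⟩ := exists_isIrrSub hA hA0
    obtain ⟨π, hπ, hπ'⟩ := exists_projection ρ hB.1
    have hdisj : B ⊓ (A ⊓ LinearMap.ker π) = ⊥ := by
      rw [eq_bot_iff]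
      rintro b ⟨hb, -, hb2⟩
      have h2 := hπ' ⟨b, hb⟩
      rw [SetLike.mem_coe, LinearMap.mem_ker] at hb2
      rw [hb2] at h2
      simpa using (congrArg Subtype.val h2).symm
    have hsup : B ⊔ (A ⊓ LinearMap.ker π) = A := by
      refine le_antisymm (sup_le hBA inf_le_left) fun a ha => ?_
      rw [Submodule.mem_sup]
      refine ⟨π a, (π a).2, a - π a, ⟨A.sub_mem ha (hBA (π a).2), ?_⟩, by abel⟩
      rw [SetLike.mem_coe, LinearMap.mem_ker, map_sub, hπ', sub_self]
    have hsum := Submodule.finrank_sup_add_finrank_inf_eq B (A ⊓ LinearMap.ker π)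
    rw [hdisj, hsup, finrank_bot, add_zero] at hsum
    have hpos : 0 < Module.finrank ℂ B :=
      Submodule.one_le_finrank_iff.2 hB.2.1
    rw [hsum]
    exact dvd_add (h B hBA hB) (ih _ (by omega) (hA.inf hπ.isInv_ker)
      (fun C hC => h C (hC.trans inf_le_left)) rfl)

end Basic

section Irreducible

variable {G : Type} [Group G] {V W U : Type} [AddCommGroup V] [Module ℂ V]
  [AddCommGroup W] [Module ℂ W] [AddCommGroup U] [Module ℂ U]

/-- A representation restricts nontrivially to `N`. -/
def Acts (ρ : Representation ℂ G V) (N : Subgroup G) : Prop := ∃ n ∈ N, ρ n ≠ 1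

lemma Acts.mono {ρ : Representation ℂ G V} {M N : Subgroup G} (h : Acts ρ M) (hMN : M ≤ N) :
    Acts ρ N := by
  obtain ⟨m, hm, h⟩ := h
  exact ⟨m, hMN hm, h⟩

lemma not_acts_iff {ρ : Representation ℂ G V} {N : Subgroup G} :
    ¬ Acts ρ N ↔ ∀ n ∈ N, ρ n = 1 := by
  simp [Acts]

lemma not_acts_iff_le {ρ : Representation ℂ G V} {N : Subgroup G} :
    ¬ Acts ρ N ↔ N ≤ ρ.ker := by
  rw [not_acts_iff]; rfl

lemma IsIrr.eq_one_of_fixed {ρ : Representation ℂ G V} (h : IsIrr ρ) (X : Subgroup G) [hX : X.Normal]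
    {v : V} (h0 : v ≠ 0) (hv : ∀ x ∈ X, ρ x v = v) : ¬ Acts ρ X := by
  let A : Submodule ℂ V :=
    { carrier := {w | ∀ x ∈ X, ρ x w = w}
      add_mem' := fun {a b} ha hb x hx => by rw [map_add, ha x hx, hb x hx]
      zero_mem' := fun x _ => map_zero _
      smul_mem' := fun c a ha x hx => by rw [map_smul, ha x hx] }
  have hA : IsInv ρ A := by
    intro g w hw x hx
    have := hw (g⁻¹ * x * g) (by simpa using hX.conj_mem x hx g⁻¹)
    rw [map_mul, map_mul, Module.End.mul_apply, Module.End.mul_apply] at this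
    conv_rhs => rw [← this, rho_self_inv]
  have hA' : A = ⊤ := (h.2 A hA).resolve_left fun h1 => h0 (by
    have : v ∈ A := hv
    rw [h1] at this
    simpa using this)
  rw [not_acts_iff]
  intro x hx
  ext w
  exact (hA'.ge (Submodule.mem_top (x := w))) x hx

lemma exists_irrSub_acts [Finite G] [FiniteDimensional ℂ V] {ρ : Representation ℂ G V} {x : G}
    (hx : ρ x ≠ 1) : ∃ B, ∃ hB : IsIrrSub ρ B, subRep ρ B hB.1 x ≠ 1 := by
  obtain ⟨w, hw⟩ : ∃ w, ρ x w ≠ w := by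
    by_contra! h
    exact hx (LinearMap.ext h)
  obtain ⟨B, -, hB, π, hπ, h⟩ := exists_irrSub_projection (isInv_top ρ) (v := ρ x w - w) trivial
    (sub_ne_zero.2 hw)
  refine ⟨B, hB, fun h1 => h ?_⟩
  rw [map_sub, hπ, h1]; simp

lemma finrank_lt_of_fixed {ρ : Representation ℂ G V} (h : IsIrr ρ) {σ : Representation ℂ G W}
    [FiniteDimensional ℂ W] (N : Subgroup G) [N.Normal] (hN : Acts ρ N) {e : V →ₗ[ℂ] W}
    (he : IsEquiv ρ σ e) (hi : Function.Injective e) {w : W} (hw0 : w ≠ 0)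
    (hw : ∀ n ∈ N, σ n w = w) : Module.finrank ℂ V < Module.finrank ℂ W := by
  have : FiniteDimensional ℂ V := Module.Finite.of_injective e hi
  refine lt_of_le_of_ne (LinearMap.finrank_le_finrank_of_injective hi) fun h1 => ?_
  obtain ⟨v, rfl⟩ := (LinearMap.injective_iff_surjective_of_finrank_eq_finrank h1).1 hi w
  refine h.eq_one_of_fixed N (v := v) (fun h => hw0 (by simp [h])) (fun n hn => hi ?_) hN
  rw [he, hw n hn]

/-- The one-dimensional representation attached to a linear character. -/
def charRep (μ : G →* ℂˣ) : Representation ℂ G ℂ where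
  toFun g := (μ g : ℂ) • 1
  map_one' := by simp
  map_mul' a b := by ext; simp [mul_comm]

@[simp] lemma charRep_apply (μ : G →* ℂˣ) (g : G) (z : ℂ) : charRep μ g z = μ g * z := by
  simp [charRep]

lemma isIrr_of_finrank_eq_one (ρ : Representation ℂ G V) (h : Module.finrank ℂ V = 1) :
    IsIrr ρ := by
  have : FiniteDimensional ℂ V := Module.finite_of_finrank_eq_succ h
  refine ⟨Module.nontrivial_of_finrank_pos (R := ℂ) (by omega), fun W _ => ?_⟩
  by_cases hW : W = ⊥
  · exact Or.inl hW
  · right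
    apply Submodule.eq_top_of_finrank_eq
    have h1 := Submodule.finrank_le W
    have h2 := Submodule.one_le_finrank_iff.2 hW
    omega

lemma charRep_isIrr (μ : G →* ℂˣ) : IsIrr (charRep μ) :=
  isIrr_of_finrank_eq_one _ (by simp)

/-- The determinant of a representation. -/
noncomputable def detChar (ρ : Representation ℂ G V) : G →* ℂˣ :=
  ((LinearMap.det : (V →ₗ[ℂ] V) →* ℂ).comp ρ).toHomUnits

@[simp] lemma detChar_coe (ρ : Representation ℂ G V) (g : G) :
    ((detChar ρ g : ℂˣ) : ℂ) = LinearMap.det (ρ g) := rfl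

lemma exists_smul_of_finrank_eq_one {V : Type*} [AddCommGroup V] [Module ℂ V]
    (h : Module.finrank ℂ V = 1) (f : V →ₗ[ℂ] V) :
    ∀ v, f v = LinearMap.det f • v := by
  obtain ⟨v, hv, h1⟩ := finrank_eq_one_iff'.1 h
  obtain ⟨c, hc⟩ := h1 (f v)
  have : f = c • LinearMap.id := by
    ext w
    obtain ⟨d, rfl⟩ := h1 w
    rw [map_smul, ← hc, LinearMap.smul_apply, LinearMap.id_apply, smul_comm]
  intro w
  rw [this, LinearMap.det_smul, h]
  simp

lemma detChar_smul (h : Module.finrank ℂ V = 1) (ρ : Representation ℂ G V) (g : G) (v : V) :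
    ρ g v = ((detChar ρ g : ℂˣ) : ℂ) • v :=
  exists_smul_of_finrank_eq_one h (ρ g) v

lemma IsIrr.schur [FiniteDimensional ℂ V] {ρ : Representation ℂ G V} (h : IsIrr ρ)
    {f : V →ₗ[ℂ] V} (hf : IsEquiv ρ ρ f) : ∃ c : ℂ, ∀ v, f v = c • v := by
  have := h.1
  obtain ⟨c, hc⟩ := Module.End.exists_eigenvalue f
  have hE : IsInv ρ (Module.End.eigenspace f c) := by
    intro g w hw
    rw [Module.End.mem_eigenspace_iff] at *
    rw [hf, hw, map_smul]
  have := (h.2 _ hE).resolve_left hc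
  refine ⟨c, fun v => Module.End.mem_eigenspace_iff.1 (this.ge (Submodule.mem_top (x := v)))⟩

lemma IsIrr.finrank_eq_one [FiniteDimensional ℂ V] {ρ : Representation ℂ G V} (h : IsIrr ρ)
    (hc : ∀ x y, ρ x * ρ y = ρ y * ρ x) : Module.finrank ℂ V = 1 := by
  have hs : ∀ x, ∃ c : ℂ, ∀ v, ρ x v = c • v := fun x => h.schur (f := ρ x) fun g v => by
    rw [← Module.End.mul_apply, hc, Module.End.mul_apply]
  have := h.1
  obtain ⟨v, hv⟩ := exists_ne (0 : V)
  have hi : IsInv ρ (Submodule.span ℂ {v}) := by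
    intro g w hw
    obtain ⟨c, hc⟩ := hs g
    rw [hc]
    exact Submodule.smul_mem _ _ hw
  have := (h.2 _ hi).resolve_left (by simpa using hv)
  rw [← finrank_top, ← this, finrank_span_singleton hv]

/-- Projecting onto the `μ`-isotypic component for a linear character `μ` of a subgroup. -/
lemma sum_eigenvector [Fintype G] (ρ : Representation ℂ G V) (X : Subgroup G) [Fintype X]
    (μ : X →* ℂˣ) (v : V) (y : X) :
    ρ y (∑ x : X, ((μ x)⁻¹ : ℂˣ).val • ρ x v) = (μ y : ℂ) • ∑ x : X, ((μ x)⁻¹ : ℂˣ).val • ρ x v := by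
  rw [map_sum, Finset.smul_sum, ← Equiv.sum_comp (Equiv.mulLeft y) (fun x => (μ y : ℂ) • _)]
  refine Finset.sum_congr rfl fun x _ => ?_
  simp only [Equiv.coe_mulLeft, map_smul, smul_smul]
  rw [← Units.val_mul, map_mul, mul_inv, mul_inv_cancel_left, Subgroup.coe_mul, map_mul,
    Module.End.mul_apply]

lemma exists_eigenvector_of_hom [Finite G] {ρ : Representation ℂ G V} {X : Subgroup G}
    {μ : X →* ℂˣ} {f : V →ₗ[ℂ] ℂ} (hf : IsEquiv (ρ.comp X.subtype) (charRep μ) f) (h0 : f ≠ 0) :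
    ∃ v, v ≠ 0 ∧ ∀ x : X, ρ x v = (μ x : ℂ) • v := by
  obtain ⟨s, hs, hs'⟩ := exists_section hf ((charRep_isIrr μ).surjective hf h0)
  refine ⟨s 1, fun h => ?_, fun x => ?_⟩
  · have := hs' 1
    rw [h] at this
    simp at this
  · have := hs x 1
    rw [charRep_apply, mul_one] at this
    rw [← map_smul, smul_eq_mul, mul_one, this]; rfl

end Irreducible

section Coinduced

variable {G : Type} [Group G] {V U : Type} [AddCommGroup V] [Module ℂ V]
  [AddCommGroup U] [Module ℂ U]

/-- The representation coinduced from a subgroup. -/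
abbrev coindV (H : Subgroup G) (σ : Representation ℂ H U) : Submodule ℂ (G → U) :=
  Representation.coindV H.subtype σ

/-- The representation coinduced from a subgroup. -/
noncomputable abbrev coindRep (H : Subgroup G) (σ : Representation ℂ H U) :
    Representation ℂ G (coindV H σ) :=
  Representation.coind H.subtype σ

variable (H : Subgroup G) (σ : Representation ℂ H U)

lemma coind_apply (f : coindV H σ) (g x : G) : (coindRep H σ g f).1 x = f.1 (x * g) := rfl

lemma coind_mul (f : coindV H σ) (h : H) (x : G) : f.1 (h * x) = σ h (f.1 x) := f.2 h x

lemma coind_mem {f : G → U} (hf : ∀ (h : H) x, f (h * x) = σ h (f x)) : f ∈ coindV H σ :=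
  fun h x => hf h x

/-- Coinduced functions are determined by their values on coset representatives. -/
noncomputable def coindEquiv :
    coindV H σ ≃ₗ[ℂ] (Quotient (QuotientGroup.rightRel H) → U) where
  toFun f q := f.1 q.out
  map_add' _ _ := rfl
  map_smul' _ _ := rfl
  invFun φ := ⟨fun g => σ ⟨g * (Quotient.mk (QuotientGroup.rightRel H) g).out⁻¹,
      QuotientGroup.rightRel_apply.1 (Quotient.mk_out (s := QuotientGroup.rightRel H) g)⟩
        (φ (Quotient.mk (QuotientGroup.rightRel H) g)), by
    refine coind_mem H σ fun h x => ?_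
    have hq : Quotient.mk (QuotientGroup.rightRel H) (h * x) =
        Quotient.mk (QuotientGroup.rightRel H) x :=
      Quotient.sound (QuotientGroup.rightRel_apply.2 (by simp))
    rw [← Module.End.mul_apply, ← map_mul]
    simp only [hq]
    congr 2
    ext
    simp [mul_assoc]⟩
  left_inv f := by
    ext g
    dsimp only
    rw [← coind_mul]
    simp
  right_inv φ := by
    ext q
    dsimp only
    have h : Quotient.mk (QuotientGroup.rightRel H) q.out = q := Quotient.out_eq q
    have h1 : (⟨q.out * (Quotient.mk (QuotientGroup.rightRel H) q.out).out⁻¹,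
      QuotientGroup.rightRel_apply.1 (Quotient.mk_out (s := QuotientGroup.rightRel H) q.out)⟩ : H)
        = 1 := by
      ext; simp [h]
    rw [h1, h]; simp

instance [Finite G] [FiniteDimensional ℂ U] : FiniteDimensional ℂ (coindV H σ) := inferInstance

lemma finrank_coind [Finite G] [FiniteDimensional ℂ U] :
    Module.finrank ℂ (coindV H σ) = H.index * Module.finrank ℂ U := by
  classical
  have : Fintype (Quotient (QuotientGroup.rightRel H)) := Fintype.ofFinite _
  rw [(coindEquiv H σ).finrank_eq, Module.finrank_pi_fintype]
  simp only [Finset.sum_const, Finset.card_univ, smul_eq_mul]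
  rw [← Nat.card_eq_fintype_card, Subgroup.index,
    Nat.card_congr (QuotientGroup.quotientRightRelEquivQuotientLeftRel H)]

/-- Evaluation at `1`. -/
def evalOne : coindV H σ →ₗ[ℂ] U := (LinearMap.proj 1) ∘ₗ (coindV H σ).subtype

lemma evalOne_apply (f : coindV H σ) : evalOne H σ f = f.1 1 := rfl

lemma evalOne_isEquiv : IsEquiv ((coindRep H σ).comp H.subtype) σ (evalOne H σ) := by
  intro h f
  rw [evalOne_apply, evalOne_apply, ← coind_mul]
  change f.1 (1 * h) = _
  simp

lemma evalOne_comp_ne_zero {A : Submodule ℂ (coindV H σ)} (hA : IsInv (coindRep H σ) A)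
    (h0 : A ≠ ⊥) : evalOne H σ ∘ₗ A.subtype ≠ 0 := by
  intro h
  apply h0
  rw [eq_bot_iff]
  intro f hf
  rw [Submodule.mem_bot]
  ext g
  have := LinearMap.congr_fun h ⟨_, hA g f hf⟩
  rw [LinearMap.comp_apply, Submodule.subtype_apply, evalOne_apply, coind_apply, one_mul] at this
  simpa using this

variable {H σ}

/-- Frobenius reciprocity: a homomorphism on the subgroup yields an equivariant map into the
coinduced representation. -/
def coindLift {ρ : Representation ℂ G V} {f : V →ₗ[ℂ] U}
    (hf : IsEquiv (ρ.comp H.subtype) σ f) : V →ₗ[ℂ] coindV H σ where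
  toFun v := ⟨fun g => f (ρ g v), coind_mem H σ fun h x => by
    rw [map_mul, Module.End.mul_apply]; exact hf h _⟩
  map_add' a b := by ext; simp
  map_smul' c a := by ext; simp

lemma coindLift_isEquiv {ρ : Representation ℂ G V} {f : V →ₗ[ℂ] U}
    (hf : IsEquiv (ρ.comp H.subtype) σ f) : IsEquiv ρ (coindRep H σ) (coindLift hf) := by
  intro g v
  ext x
  rw [coind_apply]
  simp [coindLift]

lemma coindLift_injective {ρ : Representation ℂ G V} (h : IsIrr ρ) {f : V →ₗ[ℂ] U}
    (hf : IsEquiv (ρ.comp H.subtype) σ f) (h0 : f ≠ 0) : Function.Injective (coindLift hf) := by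
  refine h.injective (coindLift_isEquiv hf) fun h1 => h0 ?_
  ext v
  have h2 := congrArg (fun w => w.1 1) (LinearMap.congr_fun h1 v)
  simpa [coindLift] using h2

lemma finrank_le_of_hom [Finite G] [FiniteDimensional ℂ U] {ρ : Representation ℂ G V}
    (h : IsIrr ρ) {f : V →ₗ[ℂ] U} (hf : IsEquiv (ρ.comp H.subtype) σ f) (h0 : f ≠ 0) :
    Module.finrank ℂ V ≤ H.index * Module.finrank ℂ U := by
  rw [← finrank_coind H σ]
  exact LinearMap.finrank_le_finrank_of_injective (coindLift_injective h hf h0)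

lemma exists_coind_delta (H : Subgroup G) (σ : H →* ℂˣ) : ∃ δ : coindV H (charRep σ),
    (∀ h : H, δ.1 h = σ h) ∧ ∀ g ∉ H, δ.1 g = 0 := by
  classical
  refine ⟨⟨fun g => if hg : g ∈ H then (σ ⟨g, hg⟩ : ℂ) else 0, coind_mem H _ fun h x => ?_⟩,
    fun h => ?_, fun g hg => ?_⟩
  · by_cases hx : x ∈ H
    · have : (h : G) * x ∈ H := H.mul_mem h.2 hx
      have e : (⟨(h : G) * x, this⟩ : H) = h * ⟨x, hx⟩ := rfl
      simp only [hx, this, dite_true, e, map_mul, charRep_apply, Units.val_mul]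
    · have : (h : G) * x ∉ H := fun h' => hx ((H.mul_mem_cancel_left h.2).1 h')
      simp only [hx, this, dite_false, map_zero]
  · simp
  · simp [hg]

lemma exists_coind_eigenvector [Finite G] (H : Subgroup G) (σ : H →* ℂˣ) (X : Subgroup G)
    (μ : X →* ℂˣ) (hμ : ∀ x (hX : x ∈ X) (hH : x ∈ H), μ ⟨x, hX⟩ = σ ⟨x, hH⟩) :
    ∃ f : coindV H (charRep σ), f ≠ 0 ∧ ∀ x : X, coindRep H (charRep σ) x f = (μ x : ℂ) • f := by
  classical
  cases nonempty_fintype G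
  have : Fintype X := Fintype.ofFinite X
  obtain ⟨δ, h1, h2⟩ := exists_coind_delta H σ
  refine ⟨_, fun h => ?_, fun x => sum_eigenvector (coindRep H (charRep σ)) X μ δ x⟩
  have h3 : ∑ x : X, (if (x : G) ∈ H then (1 : ℂ) else 0) = 0 := by
    have h4 := congrArg (fun w => w.1 1) h
    simp only [AddSubmonoidClass.coe_finsetSum, Finset.sum_apply] at h4
    refine Eq.trans ?_ h4
    refine Finset.sum_congr rfl fun x _ => ?_
    rw [Submodule.coe_smul, Pi.smul_apply, coind_apply, one_mul]
    split_ifs with hx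
    · have h5 := h1 ⟨x, hx⟩
      rw [hμ x x.2 hx, h5]
      simp
    · simp [h2 _ hx]
  rw [Finset.sum_boole] at h3
  have h6 : (1 : X) ∈ Finset.univ.filter (fun x : X => (x : G) ∈ H) := by simp [H.one_mem]
  rw [Nat.cast_eq_zero, Finset.card_eq_zero] at h3
  rw [h3] at h6
  simp at h6

end Coinduced

section Existence

variable {G : Type} [Group G] {V W U : Type} [AddCommGroup V] [Module ℂ V]
  [AddCommGroup W] [Module ℂ W] [AddCommGroup U] [Module ℂ U]

/-- `μ` occurs in the restriction of `ρ` to `X`. -/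
def HasWeight (ρ : Representation ℂ G V) (X : Subgroup G) (μ : X →* ℂˣ) : Prop :=
  ∃ v, v ≠ 0 ∧ ∀ x : X, ρ x v = (μ x : ℂ) • v

lemma HasWeight.acts {ρ : Representation ℂ G V} {X : Subgroup G} {μ : X →* ℂˣ}
    (h : HasWeight ρ X μ) {x : X} (hx : μ x ≠ 1) : Acts ρ X := by
  obtain ⟨v, h0, hv⟩ := h
  refine ⟨x, x.2, fun h1 => hx ?_⟩
  have h2 := hv x
  rw [h1, Module.End.one_apply] at h2
  have h3 : ((μ x : ℂ) - 1) • v = 0 := by rw [sub_smul, one_smul, ← h2, sub_self]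
  rw [smul_eq_zero, sub_eq_zero] at h3
  exact Units.ext (h3.resolve_right h0)

lemma exists_irr_acts_finrank_lt [Finite G] (H N : Subgroup G) [N.Normal] (hN : ¬ N ≤ H) :
    ∃ (V : Type) (_ : AddCommGroup V) (_ : Module ℂ V) (_ : FiniteDimensional ℂ V)
      (ρ : Representation ℂ G V), IsIrr ρ ∧ Acts ρ N ∧ Module.finrank ℂ V < H.index := by
  obtain ⟨n, hn, hnH⟩ := SetLike.not_le_iff_exists.1 hN
  obtain ⟨δ, h1, h2⟩ := exists_coind_delta H (1 : H →* ℂˣ)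
  obtain ⟨f, hf0, hf⟩ := exists_coind_eigenvector H 1 N 1 (fun _ _ _ => rfl)
  have hne : coindRep H (charRep 1) n ≠ 1 := by
    intro h
    have h3 := congrArg (fun w => (w δ).1 1) h
    have h4 := h1 1
    simp only [coind_apply, one_mul, h2 n hnH, Module.End.one_apply] at h3
    rw [OneMemClass.coe_one] at h4
    rw [h4] at h3
    simp at h3
  obtain ⟨B, hB, hBn⟩ := exists_irrSub_acts hne
  refine ⟨B, _, _, inferInstance, _, hB.isIrr, ⟨n, hn, hBn⟩, ?_⟩
  have := finrank_lt_of_fixed hB.isIrr N ⟨n, hn, hBn⟩ (subtype_isEquiv _ B hB.1)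
    B.injective_subtype hf0 (fun x hx => by simpa using hf ⟨x, hx⟩)
  rwa [finrank_coind, Module.finrank_self, mul_one] at this

lemma exists_irr_hasWeight_finrank_lt [Finite G] (T X : Subgroup G) [X.Normal] (μ : X →* ℂˣ)
    (h1 : μ ≠ 1) (hμ : ∀ x : X, (x : G) ∈ T → μ x = 1) :
    ∃ (V : Type) (_ : AddCommGroup V) (_ : Module ℂ V) (_ : FiniteDimensional ℂ V)
      (ρ : Representation ℂ G V), IsIrr ρ ∧ HasWeight ρ X μ ∧ Module.finrank ℂ V < T.index := by
  obtain ⟨f, hf0, hf⟩ := exists_coind_eigenvector T 1 X μ (fun x hX hT => by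
    rw [hμ ⟨x, hX⟩ hT]; rfl)
  obtain ⟨e, he0, he⟩ := exists_coind_eigenvector T 1 X 1 (fun _ _ _ => rfl)
  obtain ⟨x, hx⟩ : ∃ x, μ x ≠ 1 := by
    by_contra! h
    exact h1 (MonoidHom.ext h)
  obtain ⟨B, -, hB, π, hπ, hB0⟩ := exists_irrSub_projection
    (isInv_top (coindRep T (charRep 1))) (v := f) trivial hf0
  have hw : HasWeight (subRep _ B hB.1) X μ := ⟨π f, hB0, fun x => by rw [← hπ, hf, map_smul]⟩
  refine ⟨B, _, _, inferInstance, _, hB.isIrr, hw, ?_⟩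
  have := finrank_lt_of_fixed hB.isIrr X (hw.acts hx) (subtype_isEquiv _ B hB.1)
    B.injective_subtype he0 (fun x hx => by simpa using he ⟨x, hx⟩)
  rwa [finrank_coind, Module.finrank_self, mul_one] at this

lemma finrank_lt_index_of_hom [Finite G] (T N : Subgroup G) [N.Normal] (σ : T →* ℂˣ)
    (hσ : ∀ t : T, (t : G) ∈ N → σ t = 1) {ρ : Representation ℂ G V} (h : IsIrr ρ)
    (hN : Acts ρ N) {f : V →ₗ[ℂ] ℂ} (hf : IsEquiv (ρ.comp T.subtype) (charRep σ) f) (h0 : f ≠ 0) :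
    Module.finrank ℂ V < T.index := by
  obtain ⟨e, he0, he⟩ := exists_coind_eigenvector T σ N 1 (fun x hN hT => by
    rw [hσ ⟨x, hT⟩ hN]; rfl)
  have := finrank_lt_of_fixed h N hN (coindLift_isEquiv hf) (coindLift_injective h hf h0) he0
    (fun x hx => by simpa using he ⟨x, hx⟩)
  rwa [finrank_coind, Module.finrank_self, mul_one] at this

/-- The homomorphism attached to an eigenvector. -/
lemma toSpanSingleton_isEquiv {ρ : Representation ℂ G V} {X : Subgroup G} {μ : X →* ℂˣ} {v : V}
    (hv : ∀ x : X, ρ x v = (μ x : ℂ) • v) :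
    IsEquiv (charRep μ) (ρ.comp X.subtype) (LinearMap.toSpanSingleton ℂ V v) := by
  intro x z
  rw [charRep_apply]
  simp [hv, smul_smul, mul_comm]

/-- Every element different from `1` acts nontrivially on some irreducible representation. -/
lemma exists_irr_ne_one [Finite G] {g : G} (hg : g ≠ 1) :
    ∃ (V : Type) (_ : AddCommGroup V) (_ : Module ℂ V) (_ : FiniteDimensional ℂ V)
      (ρ : Representation ℂ G V), IsIrr ρ ∧ ρ g ≠ 1 := by
  obtain ⟨δ, h1, h2⟩ := exists_coind_delta (⊥ : Subgroup G) 1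
  have hne : coindRep ⊥ (charRep 1) g ≠ 1 := by
    intro h
    have h3 := congrArg (fun w => (w δ).1 1) h
    have h4 := h1 1
    simp only [coind_apply, one_mul, h2 g (by simpa using hg), Module.End.one_apply] at h3
    rw [OneMemClass.coe_one] at h4
    rw [h4] at h3
    simp at h3
  obtain ⟨B, hB, hBn⟩ := exists_irrSub_acts hne
  exact ⟨B, _, _, inferInstance, _, hB.isIrr, hBn⟩

end Existence

section Clifford

variable {G : Type} [Group G] {V U : Type} [AddCommGroup V] [Module ℂ V]
  [AddCommGroup U] [Module ℂ U] (K : Subgroup G) [K.Normal]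

/-- The inertia group of a representation of a normal subgroup. -/
def inertia (σ : Representation ℂ K U) : Subgroup G where
  carrier := {g | ∃ A : U →ₗ[ℂ] U, Function.Bijective A ∧
    ∀ k u, A (σ k u) = σ (MulAut.conjNormal g k) (A u)}
  mul_mem' := by
    rintro g h ⟨A, hA, hA'⟩ ⟨B, hB, hB'⟩
    refine ⟨A ∘ₗ B, hA.comp hB, fun k u => ?_⟩
    rw [LinearMap.comp_apply, hB', hA', map_mul]; rfl
  one_mem' := ⟨LinearMap.id, Function.bijective_id, fun k u => by simp⟩
  inv_mem' := by
    rintro g ⟨A, hA, hA'⟩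
    let E := LinearEquiv.ofBijective A hA
    refine ⟨E.symm.toLinearMap, E.symm.bijective, fun k u => ?_⟩
    apply E.injective
    have h1 : E (σ ((MulAut.conjNormal g⁻¹) k) (E.symm u)) = σ k (E (E.symm u)) := by
      have := hA' ((MulAut.conjNormal g⁻¹) k) (E.symm u)
      rw [← MulAut.mul_apply, ← map_mul] at this
      simpa [E] using this
    simp only [LinearEquiv.coe_coe, LinearEquiv.apply_symm_apply] at h1 ⊢
    rw [h1]

variable {K}

lemma mem_inertia_charRep {μ : K →* ℂˣ} {g : G} :
    g ∈ inertia K (charRep μ) ↔ ∀ k, μ (MulAut.conjNormal g k) = μ k := by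
  constructor
  · rintro ⟨A, hA, h⟩ k
    have h1 : A 1 ≠ 0 := fun h0 => one_ne_zero (hA.1 (h0.trans (map_zero A).symm))
    have h2 := h k 1
    rw [charRep_apply, charRep_apply, ← smul_eq_mul, map_smul, smul_eq_mul] at h2
    exact Units.ext (mul_right_cancel₀ h1 h2).symm
  · intro h
    exact ⟨LinearMap.id, Function.bijective_id, fun k u => by simp [h k]⟩

lemma le_inertia (σ : Representation ℂ K U) : K ≤ inertia K σ := by
  intro g hg
  refine ⟨σ ⟨g, hg⟩, ⟨fun u v h => ?_, fun u => ⟨σ (⟨g, hg⟩)⁻¹ u, rho_self_inv _ _ _⟩⟩, fun k u => ?_⟩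
  · rw [← rho_inv_self σ ⟨g, hg⟩ u, h, rho_inv_self]
  · rw [← Module.End.mul_apply, ← Module.End.mul_apply, ← map_mul, ← map_mul]
    congr 2
    ext; simp

/-- The sum of all copies of `σ` in the restriction of `ρ`. -/
def isotypic (ρ : Representation ℂ G V) (σ : Representation ℂ K U) : Submodule ℂ V :=
  ⨆ f : {f : U →ₗ[ℂ] V // IsEquiv σ (ρ.comp K.subtype) f}, LinearMap.range f.1

variable {ρ : Representation ℂ G V} {σ : Representation ℂ K U}

omit [K.Normal] in
lemma mem_isotypic {f : U →ₗ[ℂ] V} (hf : IsEquiv σ (ρ.comp K.subtype) f) (u : U) :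
    f u ∈ isotypic ρ σ :=
  Submodule.mem_iSup_of_mem (⟨f, hf⟩ : {f : U →ₗ[ℂ] V // IsEquiv σ (ρ.comp K.subtype) f})
    ⟨u, rfl⟩

omit [K.Normal] in
lemma isotypic_le {A : Submodule ℂ V}
    (h : ∀ f : U →ₗ[ℂ] V, IsEquiv σ (ρ.comp K.subtype) f → ∀ u, f u ∈ A) : isotypic ρ σ ≤ A := by
  refine iSup_le fun f => ?_
  rintro _ ⟨u, rfl⟩
  exact h f.1 f.2 u

lemma isotypic_isInv : IsInv (ρ.comp (inertia K σ).subtype) (isotypic ρ σ) := by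
  rintro ⟨g, hg⟩
  have hg' := hg
  obtain ⟨A, hA, hA'⟩ := (inertia K σ).inv_mem hg
  suffices h : isotypic ρ σ ≤ (isotypic ρ σ).comap (ρ g) from fun w hw => h hw
  refine isotypic_le fun f hf u => ?_
  obtain ⟨B, hB, hB'⟩ := hg'
  let E := LinearEquiv.ofBijective B hB
  have hE : ∀ u, E u = B u := fun _ => rfl
  have h1 : IsEquiv σ (ρ.comp K.subtype) (ρ g ∘ₗ f ∘ₗ E.symm.toLinearMap) := by
    intro k u
    obtain ⟨u, rfl⟩ := E.surjective u
    obtain ⟨k, rfl⟩ := (MulAut.conjNormal g : K ≃* K).surjective k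
    have h2 := hB' k u
    rw [← hE, ← hE] at h2
    simp only [LinearMap.comp_apply, LinearEquiv.coe_coe, LinearEquiv.symm_apply_apply]
    rw [← h2, LinearEquiv.symm_apply_apply, hf]
    simp only [MonoidHom.comp_apply, Subgroup.coe_subtype, MulAut.conjNormal_apply]
    rw [← Module.End.mul_apply, ← Module.End.mul_apply, ← map_mul, ← map_mul]
    simp
  have h3 := mem_isotypic h1 (E u)
  simpa using h3

/-- Translates of `isotypic ρ σ` have no common constituents unless they agree. -/
lemma mem_inertia_of_twisted {W : Type} [AddCommGroup W] [Module ℂ W] {τ : Representation ℂ K W}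
    (hσ : IsIrr σ) (hτ : IsIrr τ) {g h : G} {φ ψ : U →ₗ[ℂ] W} (hφ0 : φ ≠ 0) (hψ0 : ψ ≠ 0)
    (hφ : ∀ k u, φ (σ k u) = τ (MulAut.conjNormal g k) (φ u))
    (hψ : ∀ k u, ψ (σ k u) = τ (MulAut.conjNormal h k) (ψ u)) : h⁻¹ * g ∈ inertia K σ := by
  have key : ∀ (g : G) (φ : U →ₗ[ℂ] W), φ ≠ 0 →
      (∀ k u, φ (σ k u) = τ (MulAut.conjNormal g k) (φ u)) → Function.Bijective φ := by
    intro g φ h0 h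
    let τ' : Representation ℂ K W := τ.comp (MulAut.conjNormal g : K ≃* K).toMonoidHom
    have he : IsEquiv σ τ' φ := h
    have hτ' : IsIrr τ' := by
      refine ⟨hτ.1, fun A hA => hτ.2 A fun k w hw => ?_⟩
      have h2 := hA ((MulAut.conjNormal g : K ≃* K).symm k) w hw
      simpa [τ'] using h2
    exact ⟨hσ.injective he h0, hτ'.surjective he h0⟩
  let E := LinearEquiv.ofBijective ψ (key h ψ hψ0 hψ)
  have hE : ∀ u, E u = ψ u := fun _ => rfl
  refine ⟨E.symm.toLinearMap ∘ₗ φ, E.symm.bijective.comp (key g φ hφ0 hφ), fun k u => ?_⟩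
  apply E.injective
  simp only [LinearMap.comp_apply, LinearEquiv.coe_coe, LinearEquiv.apply_symm_apply]
  rw [hE, hψ, ← hE, LinearEquiv.apply_symm_apply, ← MulAut.mul_apply, ← map_mul, hφ]
  simp

lemma exists_hom_ne_zero {W : Type} [AddCommGroup W] [Module ℂ W] {τ : Representation ℂ K W}
    {π : V →ₗ[ℂ] W} (g : G) {w : V} (hw : w ∈ (isotypic ρ σ).map (ρ g))
    (h0 : π w ≠ 0) (hπ : IsEquiv (ρ.comp K.subtype) τ π) :
    ∃ φ : U →ₗ[ℂ] W, φ ≠ 0 ∧ ∀ k u, φ (σ k u) = τ (MulAut.conjNormal g k) (φ u) := by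
  by_contra! hcon
  have h : isotypic ρ σ ≤ LinearMap.ker (π ∘ₗ ρ g) := by
    refine isotypic_le fun f hf u => ?_
    by_contra h1
    have h2 : π ∘ₗ ρ g ∘ₗ f ≠ 0 := fun h => h1 (LinearMap.congr_fun h u)
    obtain ⟨k, u, hk⟩ := hcon _ h2
    apply hk
    simp only [LinearMap.comp_apply]
    rw [hf, ← hπ]
    simp only [MonoidHom.comp_apply, Subgroup.coe_subtype, MulAut.conjNormal_apply]
    congr 1
    rw [← Module.End.mul_apply, ← Module.End.mul_apply, ← map_mul, ← map_mul]
    simp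
  obtain ⟨v, hv, rfl⟩ := hw
  exact h0 (h hv)

lemma isInv_translate (g : G) {A : Submodule ℂ V} (hA : IsInv (ρ.comp K.subtype) A) :
    IsInv (ρ.comp K.subtype) (A.map (ρ g)) := by
  rintro k _ ⟨v, hv, rfl⟩
  refine ⟨_, hA ((MulAut.conjNormal g : K ≃* K).symm k) v hv, ?_⟩
  simp only [MonoidHom.comp_apply, Subgroup.coe_subtype, MulAut.conjNormal_symm_apply]
  rw [← Module.End.mul_apply, ← Module.End.mul_apply, ← map_mul, ← map_mul]
  simp [mul_assoc]

lemma isotypic_isInv_self : IsInv (ρ.comp K.subtype) (isotypic ρ σ) := by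
  intro k w hw
  have h := isotypic_isInv (ρ := ρ) (σ := σ) ⟨(k : G), le_inertia σ k.2⟩ w hw
  exact h

omit [K.Normal] in
lemma isotypic_ne_bot {s : U →ₗ[ℂ] V} (hs : IsEquiv σ (ρ.comp K.subtype) s) (h0 : s ≠ 0) :
    isotypic ρ σ ≠ ⊥ := by
  intro h
  apply h0
  ext u
  have := mem_isotypic hs u
  rw [h] at this
  simpa using this

variable [Finite G] [FiniteDimensional ℂ V]

lemma finrank_dvd_isotypic (hσ : IsIrr σ) : Module.finrank ℂ U ∣ Module.finrank ℂ (isotypic ρ σ) := by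
  refine dvd_finrank (ρ := ρ.comp K.subtype) isotypic_isInv_self fun B hB hB' => ?_
  obtain ⟨π, hπ, hπ'⟩ := exists_projection _ hB'.1
  obtain ⟨b, hb, hb0⟩ := Submodule.exists_mem_ne_zero_of_ne_bot hB'.2.1
  obtain ⟨φ, h0, hφ⟩ := exists_hom_ne_zero (σ := σ) (ρ := ρ) (w := b) (π := π) 1
    (by simpa using hB hb) (by have := hπ' ⟨b, hb⟩; dsimp only at this; rw [this]; simpa using hb0) hπ
  have he : IsEquiv σ (subRep _ B hB'.1) φ := fun k u => by simpa using hφ k u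
  have := (LinearEquiv.ofBijective φ ⟨hσ.injective he h0, hB'.isIrr.surjective he h0⟩).finrank_eq
  rw [this]

/-- Clifford's theorem: dimension count. -/
lemma finrank_eq_index_mul (hρ : IsIrr ρ) (hσ : IsIrr σ) {s : U →ₗ[ℂ] V}
    (hs : IsEquiv σ (ρ.comp K.subtype) s) (h0 : s ≠ 0) :
    Module.finrank ℂ V = (inertia K σ).index * Module.finrank ℂ (isotypic ρ σ) := by
  classical
  let t : G ⧸ inertia K σ → Submodule ℂ V := fun q => (isotypic ρ σ).map (ρ q.out)
  have hinj : ∀ g, Function.Injective (ρ g) := fun g u v h => by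
    rw [← rho_inv_self ρ g u, h, rho_inv_self]
  have ht : ∀ g : G, (isotypic ρ σ).map (ρ g) ≤ t (QuotientGroup.mk g) := by
    rintro g _ ⟨v, hv, rfl⟩
    obtain ⟨h, hh⟩ := QuotientGroup.mk_out_eq_mul (inertia K σ) g
    refine ⟨ρ (h : G)⁻¹ v, isotypic_isInv h⁻¹ v hv, ?_⟩
    rw [hh, ← Module.End.mul_apply, ← map_mul]
    simp
  have hind : iSupIndep t := by
    intro i
    rw [disjoint_iff]
    by_contra hne
    have hinv : ∀ q, IsInv (ρ.comp K.subtype) (t q) :=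
      fun q => isInv_translate _ isotypic_isInv_self
    have hinv2 : IsInv (ρ.comp K.subtype) (⨆ j, ⨆ (_ : j ≠ i), t j) := by
      intro k
      suffices h : (⨆ j, ⨆ (_ : j ≠ i), t j) ≤ (⨆ j, ⨆ (_ : j ≠ i), t j).comap (ρ k) from
        fun w hw => h hw
      refine iSup₂_le fun j hj w hw => ?_
      exact (le_iSup₂_of_le (f := fun j (_ : j ≠ i) => t j) j hj le_rfl) (hinv j k w hw)
    obtain ⟨B, hB, hB'⟩ := exists_isIrrSub ((hinv i).inf hinv2) hne
    obtain ⟨π, hπ, hπ'⟩ := exists_projection _ hB'.1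
    obtain ⟨b, hb, hb0⟩ := Submodule.exists_mem_ne_zero_of_ne_bot hB'.2.1
    have hπb : π b ≠ 0 := by
      have := hπ' ⟨b, hb⟩; dsimp only at this; rw [this]; simpa using hb0
    obtain ⟨j, hj, w, hw, hw0⟩ : ∃ j, j ≠ i ∧ ∃ w ∈ t j, π w ≠ 0 := by
      by_contra! hcon
      have : (⨆ j, ⨆ (_ : j ≠ i), t j) ≤ LinearMap.ker π :=
        iSup₂_le fun j hj w hw => hcon j hj w hw
      exact hπb (this (hB hb).2)
    obtain ⟨φ, hφ0, hφ⟩ := exists_hom_ne_zero _ (hB hb).1 hπb hπ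
    obtain ⟨ψ, hψ0, hψ⟩ := exists_hom_ne_zero _ hw hw0 hπ
    have := mem_inertia_of_twisted hσ hB'.isIrr hφ0 hψ0 hφ hψ
    rw [← QuotientGroup.eq, QuotientGroup.out_eq', QuotientGroup.out_eq'] at this
    exact hj this
  have hsup : iSup t = ⊤ := by
    have hinv : IsInv ρ (iSup t) := by
      intro g
      suffices h : iSup t ≤ (iSup t).comap (ρ g) from fun w hw => h hw
      refine iSup_le fun q => ?_
      rintro _ ⟨v, hv, rfl⟩
      apply (le_iSup t _) ((ht (g * q.out)) _)
      refine ⟨v, hv, ?_⟩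
      rw [map_mul]; rfl
    refine (hρ.2 _ hinv).resolve_left fun h => h0 ?_
    ext u
    have h1 := (le_iSup t _) (ht 1 ⟨_, mem_isotypic hs u, rfl⟩)
    rw [h] at h1
    simpa using h1
  have hsum := DirectSum.isInternal_submodule_of_iSupIndep_of_iSup_eq_top hind hsup
  have : Fintype (G ⧸ inertia K σ) := Fintype.ofFinite _
  rw [← (LinearEquiv.ofBijective (DirectSum.coeLinearMap t) hsum).finrank_eq,
    Module.finrank_directSum]
  have : ∀ q, Module.finrank ℂ (t q) = Module.finrank ℂ (isotypic ρ σ) := fun q =>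
    (Submodule.equivMapOfInjective _ (hinj _) _).finrank_eq.symm
  simp only [this, Finset.sum_const, Finset.card_univ, smul_eq_mul]
  rw [← Nat.card_eq_fintype_card, Subgroup.index]

lemma index_mul_finrank_dvd (hρ : IsIrr ρ) (hσ : IsIrr σ) {s : U →ₗ[ℂ] V}
    (hs : IsEquiv σ (ρ.comp K.subtype) s) (h0 : s ≠ 0) {T : Subgroup G} (hT : inertia K σ ≤ T) :
    T.index * Module.finrank ℂ U ∣ Module.finrank ℂ V := by
  rw [finrank_eq_index_mul hρ hσ hs h0]
  exact mul_dvd_mul (Subgroup.index_dvd_of_le hT) (finrank_dvd_isotypic hσ)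

lemma index_inertia_le (hρ : IsIrr ρ) (hσ : IsIrr σ) {s : U →ₗ[ℂ] V}
    (hs : IsEquiv σ (ρ.comp K.subtype) s) (h0 : s ≠ 0) :
    (inertia K σ).index ≤ Module.finrank ℂ V := by
  rw [finrank_eq_index_mul hρ hσ hs h0]
  exact Nat.le_mul_of_pos_right _ (Submodule.one_le_finrank_iff.2 (isotypic_ne_bot hs h0))

end Clifford

section MinimalDegree

variable {G : Type} [Group G] [Finite G] {V U : Type} [AddCommGroup V] [Module ℂ V]
  [AddCommGroup U] [Module ℂ U] [FiniteDimensional ℂ V]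

/-- All irreducible representations nontrivial on `N` have degree at least `a`. -/
def MinDegree (G : Type) [Group G] (N : Subgroup G) (a : ℕ) : Prop :=
  ∀ (V : Type) [AddCommGroup V] [Module ℂ V] [FiniteDimensional ℂ V] (ρ : Representation ℂ G V),
    IsIrr ρ → Acts ρ N → a ≤ Module.finrank ℂ V

lemma le_inertia_of_minDegree {N : Subgroup G} [N.Normal] {a : ℕ} (ha : MinDegree G N a)
    {ρ : Representation ℂ G V} (hρ : IsIrr ρ) (hV : Module.finrank ℂ V ≤ a) {K : Subgroup G}
    [K.Normal] {σ : Representation ℂ K U} (hσ : IsIrr σ) {s : U →ₗ[ℂ] V}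
    (hs : IsEquiv σ (ρ.comp K.subtype) s) (h0 : s ≠ 0) : N ≤ inertia K σ := by
  by_contra hN
  obtain ⟨V', _, _, _, ρ', h1, h2, h3⟩ := exists_irr_acts_finrank_lt _ _ hN
  have := index_inertia_le hρ hσ hs h0
  have := ha V' ρ' h1 h2
  omega

/-- The stabilizer of a vector. -/
def fixSub {V : Type} [AddCommGroup V] [Module ℂ V] (ρ : Representation ℂ G V) (v : V) :
    Subgroup G where
  carrier := {g | ρ g v = v}
  mul_mem' := by
    intro a b ha hb
    simp only [Set.mem_ofPred_eq] at *
    rw [map_mul, Module.End.mul_apply, hb, ha]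
  one_mem' := by simp
  inv_mem' := by
    intro a ha
    simp only [Set.mem_ofPred_eq] at *
    conv_lhs => rw [← ha, rho_inv_self]

omit [Finite G] [FiniteDimensional ℂ V] in
lemma mem_fixSub {ρ : Representation ℂ G V} {v : V} {g : G} : g ∈ fixSub ρ v ↔ ρ g v = v := Iff.rfl

omit [Finite G] [FiniteDimensional ℂ V] in
lemma not_acts_commutator_of_weight {ρ : Representation ℂ G V} (hρ : IsIrr ρ) {A N : Subgroup G}
    [A.Normal] [N.Normal] {μ : A →* ℂˣ} {v : V} (h0 : v ≠ 0)
    (hv : ∀ x : A, ρ x v = (μ x : ℂ) • v) (hN : N ≤ inertia A (charRep μ)) :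
    ¬ Acts ρ ⁅A, N⁆ := by
  refine hρ.eq_one_of_fixed _ h0 fun x hx => ?_
  suffices h : ⁅A, N⁆ ≤ fixSub ρ v from h hx
  rw [Subgroup.commutator_le]
  intro x hx n hn
  rw [mem_fixSub]
  have h1 := mem_inertia_charRep.1 (hN hn) (⟨x, hx⟩)⁻¹
  have h2 : ⁅x, n⁆ = x * (MulAut.conjNormal n (⟨x, hx⟩⁻¹ : A) : A) := by
    simp [commutatorElement_def, mul_assoc]
  rw [h2, map_mul, Module.End.mul_apply, hv, map_smul, h1]
  have h3 := hv ⟨x, hx⟩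
  dsimp only at h3
  rw [h3, smul_smul, ← Units.val_mul]
  simp

omit [Finite G] in
lemma exists_weight_of_commute {ρ : Representation ℂ G V} (hρ : IsIrr ρ) {A : Subgroup G}
    (hA : ∀ x ∈ A, ∀ y ∈ A, ρ x * ρ y = ρ y * ρ x) :
    ∃ μ : A →* ℂˣ, HasWeight ρ A μ := by
  have := hρ.1
  obtain ⟨W, -, hW⟩ := exists_isIrrSub (isInv_top (ρ.comp A.subtype)) top_ne_bot
  have h1 : Module.finrank ℂ W = 1 := hW.isIrr.finrank_eq_one fun x y => by
    ext w
    have := LinearMap.congr_fun (hA x x.2 y y.2) (w : V)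
    simpa using this
  obtain ⟨w, hw, hw0⟩ := Submodule.exists_mem_ne_zero_of_ne_bot hW.2.1
  refine ⟨detChar (subRep _ W hW.1), w, hw0, fun x => ?_⟩
  exact congrArg Subtype.val (detChar_smul h1 (subRep _ W hW.1) x ⟨w, hw⟩)

lemma le_inertia_of_weight {N : Subgroup G} [N.Normal] {a : ℕ} (ha : MinDegree G N a)
    {ρ : Representation ℂ G V} (hρ : IsIrr ρ) (hV : Module.finrank ℂ V ≤ a) {A : Subgroup G}
    [A.Normal] {μ : A →* ℂˣ} {v : V} (h0 : v ≠ 0) (hv : ∀ x : A, ρ x v = (μ x : ℂ) • v) :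
    N ≤ inertia A (charRep μ) := by
  refine le_inertia_of_minDegree ha hρ hV (charRep_isIrr μ) (toSpanSingleton_isEquiv hv) fun h => ?_
  apply h0
  simpa using LinearMap.congr_fun h 1

lemma not_acts_commutator {N : Subgroup G} [N.Normal] {a : ℕ} (ha : MinDegree G N a)
    {ρ : Representation ℂ G V} (hρ : IsIrr ρ) (hV : Module.finrank ℂ V ≤ a) {A : Subgroup G}
    [A.Normal] (hA : ∀ x ∈ A, ∀ y ∈ A, ρ x * ρ y = ρ y * ρ x) : ¬ Acts ρ ⁅A, N⁆ := by
  obtain ⟨μ, v, h0, hv⟩ := exists_weight_of_commute hρ hA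
  exact not_acts_commutator_of_weight hρ h0 hv (le_inertia_of_weight ha hρ hV h0 hv)

end MinimalDegree

section PGroup

variable {S : Type} [Group S]

lemma exists_mem_center_of_pGroup [Finite S] {p : ℕ} [Fact p.Prime] (hS : IsPGroup p S)
    (N : Subgroup S) [N.Normal] (hN : N ≠ ⊥) : ∃ x ∈ N, x ≠ 1 ∧ x ∈ Subgroup.center S := by
  let _ : MulAction S N := MulAction.compHom N (MulAut.conjNormal : S →* MulAut N)
  have hsm : ∀ (s : S) (n : N), ((s • n : N) : S) = s * n * s⁻¹ := fun s n => rfl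
  have hd : p ∣ Nat.card N := (hS.to_subgroup N).card_eq_or_dvd.resolve_left fun h =>
    hN (Subgroup.card_eq_one.1 h)
  have h1 : (1 : N) ∈ MulAction.fixedPoints S N := fun s => by ext; simp [hsm]
  obtain ⟨b, hb, hb1⟩ := hS.exists_fixed_point_of_prime_dvd_card_of_fixed_point N hd h1
  refine ⟨b, b.2, fun h => hb1 (by ext; simp [h]), ?_⟩
  rw [Subgroup.mem_center_iff]
  intro g
  have := congrArg Subtype.val (hb g)
  rw [hsm] at this
  exact mul_inv_eq_iff_eq_mul.1 this

lemma normal_of_le_center {H : Subgroup S} (h : H ≤ Subgroup.center S) : H.Normal :=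
  ⟨fun n hn g => by rw [Subgroup.mem_center_iff.1 (h hn) g]; simpa using hn⟩

lemma exists_abelian_normal_aux [Finite S] {p : ℕ} [Fact p.Prime] (hS : IsPGroup p S)
    (P : Subgroup S) [hP : P.Normal] (hne : ⁅P, P⁆ ≠ ⊥) :
    ∃ A : Subgroup S, A.Normal ∧ A ≤ P ∧ ⁅A, A⁆ = ⊥ ∧ ⁅A, P⁆ ≠ ⊥ := by
  let Z : Subgroup S := P ⊓ Subgroup.centralizer P
  have hZ : Z.Normal := inferInstance
  obtain ⟨y, hyP, hyZ⟩ : ∃ y ∈ P, y ∉ Z := by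
    by_contra! h
    refine hne (Subgroup.commutator_eq_bot_iff_le_centralizer.2 fun y hy => (h y hy).2)
  let π := QuotientGroup.mk' Z
  have hP' : (P.map π).Normal := hP.map π (QuotientGroup.mk'_surjective Z)
  obtain ⟨xb, ⟨x, hx, rfl⟩, hx1, hxc⟩ := exists_mem_center_of_pGroup (hS.to_quotient Z) (P.map π)
    (fun h => hyZ (by
      have : π y ∈ P.map π := ⟨y, hyP, rfl⟩
      rw [h, Subgroup.mem_bot] at this
      exact (QuotientGroup.eq_one_iff y).1 this))
  have hxZ : x ∉ Z := fun h => hx1 ((QuotientGroup.eq_one_iff x).2 h)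
  have hA : (Subgroup.zpowers (π x)).Normal := normal_of_le_center (by simpa using hxc)
  have hAeq : (Subgroup.zpowers (π x)).comap π = Subgroup.zpowers x ⊔ Z := by
    rw [← MonoidHom.map_zpowers, Subgroup.comap_map_eq, QuotientGroup.ker_mk']
  have hAP : Subgroup.zpowers x ⊔ Z ≤ P := sup_le (by simpa using hx) inf_le_left
  refine ⟨(Subgroup.zpowers (π x)).comap π, inferInstance, hAeq ▸ hAP, ?_, fun h => hxZ ?_⟩
  · rw [hAeq, Subgroup.commutator_eq_bot_iff_le_centralizer]
    have hZc : Z ≤ Subgroup.centralizer (Subgroup.zpowers x ⊔ Z : Subgroup S) :=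
      inf_le_right.trans (Subgroup.centralizer_le hAP)
    refine sup_le ?_ hZc
    rw [Subgroup.le_centralizer_iff]
    refine sup_le ?_ ?_
    · exact Subgroup.le_centralizer_iff_isMulCommutative.2 inferInstance
    · exact inf_le_right.trans (Subgroup.centralizer_le (by simpa using hx))
  · refine ⟨hx, Subgroup.commutator_eq_bot_iff_le_centralizer.1 h ?_⟩
    rw [hAeq]
    exact le_sup_left (a := Subgroup.zpowers x) (Subgroup.mem_zpowers x)

lemma exists_abelian_normal [Finite S] {p : ℕ} [Fact p.Prime] (hS : IsPGroup p S)
    (P X : Subgroup S) [hP : P.Normal] [hX : X.Normal] (hne : ¬ ⁅P, P⁆ ≤ X) :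
    ∃ A : Subgroup S, A.Normal ∧ A ≤ P ∧ ⁅A, A⁆ ≤ X ∧ ¬ ⁅A, P⁆ ≤ X := by
  let π := QuotientGroup.mk' X
  have hker : ∀ H : Subgroup S, H ≤ X ↔ H.map π = ⊥ := fun H => by
    rw [Subgroup.map_eq_bot_iff, QuotientGroup.ker_mk']
  have hP' : (P.map π).Normal := hP.map π (QuotientGroup.mk'_surjective X)
  obtain ⟨A, hA, hAP, h1, h2⟩ := exists_abelian_normal_aux (hS.to_quotient X) (P.map π) (by
    rwa [← Subgroup.map_commutator, Ne, ← hker])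
  have hmap : (P ⊓ A.comap π).map π = A := by
    refine le_antisymm (fun _ => ?_) fun a ha => ?_
    · rintro ⟨x, hx, rfl⟩; exact hx.2
    · obtain ⟨x, hx, rfl⟩ := hAP ha
      exact ⟨x, ⟨hx, ha⟩, rfl⟩
  refine ⟨P ⊓ A.comap π, inferInstance, inf_le_left, ?_, ?_⟩
  · rw [hker, Subgroup.map_commutator, hmap, h1]
  · rw [hker, Subgroup.map_commutator, hmap]
    exact h2

variable {V : Type} [AddCommGroup V] [Module ℂ V]

lemma commute_of_commutator_le_ker {ρ : Representation ℂ S V} {A B : Subgroup S}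
    (h : ⁅A, B⁆ ≤ ρ.ker) : ∀ x ∈ A, ∀ y ∈ B, ρ x * ρ y = ρ y * ρ x := by
  intro x hx y hy
  have h1 : ρ ⁅x, y⁆ = 1 := h (Subgroup.commutator_mem_commutator hx hy)
  have h2 : x * y = ⁅x, y⁆ * (y * x) := by simp [commutatorElement_def, mul_assoc]
  rw [← map_mul, h2, map_mul, h1, one_mul, map_mul]

/-- Irreducible representations of `p`-groups have `p`-power degree. -/
lemma exists_finrank_eq_pow {p : ℕ} [Fact p.Prime] (S : Type) [Group S] [Finite S]
    (hS : IsPGroup p S) (V : Type) [AddCommGroup V] [Module ℂ V] [FiniteDimensional ℂ V]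
    (ρ : Representation ℂ S V) (hρ : IsIrr ρ) : ∃ k, Module.finrank ℂ V = p ^ k := by
  induction hn : Nat.card S using Nat.strong_induction_on generalizing S V with
  | _ n ih =>
    subst hn
    by_cases hc : ⁅(⊤ : Subgroup S), (⊤ : Subgroup S)⁆ ≤ ρ.ker
    · refine ⟨0, hρ.finrank_eq_one fun x y => ?_⟩
      exact commute_of_commutator_le_ker hc x trivial y trivial
    obtain ⟨A, hA, -, hA1, hA2⟩ := exists_abelian_normal hS ⊤ ρ.ker hc
    obtain ⟨μ, v, h0, hv⟩ := exists_weight_of_commute hρ (commute_of_commutator_le_ker hA1)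
    have hT : inertia A (charRep μ) ≠ ⊤ := fun h => by
      have := not_acts_commutator_of_weight (N := ⊤) hρ h0 hv h.ge
      exact hA2 (not_acts_iff_le.1 this)
    set T := inertia A (charRep μ) with hTdef
    have hs := toSpanSingleton_isEquiv hv
    have hs0 : LinearMap.toSpanSingleton ℂ V v ≠ 0 := fun h => h0 (by
      simpa using LinearMap.congr_fun h 1)
    have hdim := finrank_eq_index_mul hρ (charRep_isIrr μ) hs hs0
    obtain ⟨W, hWY, hW⟩ := exists_isIrrSub (isotypic_isInv (ρ := ρ) (σ := charRep μ))
      (isotypic_ne_bot hs hs0)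
    obtain ⟨π, hπ, hπ'⟩ := exists_projection _ hW.1
    have hπ0 : π ≠ 0 := by
      obtain ⟨b, hb, hb0⟩ := Submodule.exists_mem_ne_zero_of_ne_bot hW.2.1
      intro h
      have := hπ' ⟨b, hb⟩
      rw [h] at this
      exact hb0 (congrArg Subtype.val this).symm
    have hle := finrank_le_of_hom hρ hπ hπ0
    have hle2 := Submodule.finrank_mono hWY
    rw [hdim] at hle
    have hpos : 0 < (inertia A (charRep μ)).index := Nat.pos_of_ne_zero Subgroup.index_ne_zero_of_finite
    have heq := le_antisymm (Nat.le_of_mul_le_mul_left hle hpos) hle2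
    obtain ⟨k, hk⟩ := ih (Nat.card T) (by
      refine lt_of_le_of_ne (Subgroup.card_le_card_group T) fun h => hT ?_
      exact Subgroup.eq_top_of_card_eq T h) T (hS.to_subgroup T) W _ hW.isIrr rfl
    obtain ⟨m, hm⟩ := hS.index T
    exact ⟨m + k, by rw [hdim, heq, hk, ← hTdef, hm, pow_add]⟩

lemma not_acts_commutator_self_of_pGroup {p : ℕ} [Fact p.Prime] [Finite S]
    [FiniteDimensional ℂ V] (hS : IsPGroup p S) (P : Subgroup S) [P.Normal] {d : ℕ}
    (hd : MinDegree S P d) {ρ : Representation ℂ S V} (hρ : IsIrr ρ) (hV : Module.finrank ℂ V ≤ d) :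
    ¬ Acts ρ ⁅P, P⁆ := by
  rw [not_acts_iff_le]
  by_contra hne
  obtain ⟨A, hA, hAP, hA1, hA2⟩ := exists_abelian_normal hS P ρ.ker hne
  exact hA2 (not_acts_iff_le.1 (not_acts_commutator hd hρ hV (commute_of_commutator_le_ker hA1)))

end PGroup

section Sylow

variable {G : Type} [Group G] [Finite G]

lemma mul_dvd_pow_of_lt {p j k : ℕ} (hp : p.Prime) (h : p ^ j < p ^ k) : p * p ^ j ∣ p ^ k := by
  rw [← pow_succ']
  exact pow_dvd_pow p ((Nat.pow_lt_pow_iff_right hp.one_lt).1 h)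

omit [Finite G] in
lemma commutator_subgroupOf {S P : Subgroup G} (h : P ≤ S) :
    ⁅P.subgroupOf S, P.subgroupOf S⁆.map S.subtype = ⁅P, P⁆ := by
  rw [Subgroup.map_commutator, Subgroup.map_subgroupOf_eq_of_le h]

lemma dvd_card_of_sylow {p : ℕ} [Fact p.Prime] (P : Subgroup G) [P.Normal] (hP : P ≠ ⊥)
    (hp : IsPGroup p P) : ∃ d : ℕ,
    (∀ (V : Type) [AddCommGroup V] [Module ℂ V] [FiniteDimensional ℂ V]
      (ρ : Representation ℂ G V), IsIrr ρ → Acts ρ ⁅P, P⁆ → p * d ∣ Module.finrank ℂ V) ∧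
    (∃ (V : Type) (_ : AddCommGroup V) (_ : Module ℂ V) (_ : FiniteDimensional ℂ V)
      (ρ : Representation ℂ G V), IsIrr ρ ∧ Acts ρ P ∧ ¬ p * d ∣ Module.finrank ℂ V) ∧
    (∀ A : Subgroup G, IsPGroup p A → ¬ P ≤ A → p * d * Nat.card A ∣ Nat.card G) ∧ ∃ j, d = p ^ j := by
  classical
  have hpp : p.Prime := Fact.out
  obtain ⟨S, hPS⟩ := hp.exists_le_sylow
  let P' : Subgroup S := P.subgroupOf S
  have hS : IsPGroup p S := S.isPGroup'
  have hex : ∃ d, ∃ (V : Type) (_ : AddCommGroup V) (_ : Module ℂ V) (_ : FiniteDimensional ℂ V)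
      (ρ : Representation ℂ S V), IsIrr ρ ∧ Acts ρ P' ∧ Module.finrank ℂ V = d := by
    obtain ⟨x, hx, hx1⟩ := P.bot_or_exists_ne_one.resolve_left hP
    obtain ⟨V, _, _, _, ρ, h1, h2⟩ := exists_irr_ne_one (g := (⟨x, hPS hx⟩ : S))
      (fun h => hx1 (congrArg Subtype.val h))
    exact ⟨_, V, _, _, inferInstance, ρ, h1, ⟨⟨x, hPS hx⟩, hx, h2⟩, rfl⟩
  have hmin : MinDegree S P' (Nat.find hex) := fun V _ _ _ ρ h1 h2 =>
    Nat.find_min' hex ⟨V, _, _, inferInstance, ρ, h1, h2, rfl⟩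
  obtain ⟨U, _, _, _, τ, hτ, hτP, hd⟩ := Nat.find_spec hex
  generalize Nat.find hex = d at hmin hd
  obtain ⟨j, hj⟩ := exists_finrank_eq_pow S hS U τ hτ
  have hdj : d = p ^ j := hd ▸ hj
  refine ⟨d, fun V _ _ _ ρ hρ hact => ?_, ?_, fun A hA hPA => ?_, j, hdj⟩
  · rw [← finrank_top ℂ V]
    refine dvd_finrank (ρ := ρ.comp S.toSubgroup.subtype) (isInv_top _) fun B _ hB => ?_
    obtain ⟨k, hk⟩ := exists_finrank_eq_pow S hS B _ hB.isIrr
    rw [hk, hdj]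
    refine mul_dvd_pow_of_lt hpp ?_
    by_contra! hle
    have hna := not_acts_commutator_self_of_pGroup hS P' hmin hB.isIrr (by rw [hk, hdj]; exact hle)
    rw [not_acts_iff] at hna
    obtain ⟨b, hb, hb0⟩ := Submodule.exists_mem_ne_zero_of_ne_bot hB.2.1
    refine hρ.eq_one_of_fixed ⁅P, P⁆ hb0 (fun x hx => ?_) hact
    rw [← commutator_subgroupOf hPS] at hx
    obtain ⟨y, hy, rfl⟩ := hx
    exact congrArg Subtype.val (LinearMap.congr_fun (hna y hy) ⟨b, hb⟩)
  · by_contra! hcon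
    have h1 : p * d ∣ Module.finrank ℂ (⊤ : Submodule ℂ (coindV S.toSubgroup τ)) := by
      refine dvd_finrank (ρ := coindRep S.toSubgroup τ) (isInv_top _) fun B _ hB => ?_
      refine hcon B _ _ inferInstance _ hB.isIrr ?_
      by_contra hna
      rw [not_acts_iff] at hna
      obtain ⟨x, hx, hx1⟩ := hτP
      apply hx1
      have he := (evalOne_isEquiv S.toSubgroup τ).comp
        ((subtype_isEquiv _ B hB.1).restrict S.toSubgroup)
      have hsurj := hτ.surjective he (evalOne_comp_ne_zero _ _ hB.1 hB.2.1)
      ext u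
      obtain ⟨w, rfl⟩ := hsurj u
      rw [← he]
      have h2 := hna x hx
      simp only [MonoidHom.comp_apply, Subgroup.coe_subtype, h2, Module.End.one_apply]
    rw [finrank_top, finrank_coind, hd] at h1
    have hd0 : 0 < d := hdj ▸ pow_pos hpp.pos j
    exact S.not_dvd_index (Nat.dvd_of_mul_dvd_mul_right hd0 h1)
  · obtain ⟨S', hAS'⟩ := hA.exists_le_sylow
    obtain ⟨g, hg⟩ := MulAction.exists_smul_eq G S' S
    let A1 : Subgroup G := A.map (MulAut.conj g).toMonoidHom
    have hcard : Nat.card A1 = Nat.card A :=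
      Subgroup.card_map_of_injective (MulAut.conj g).injective
    have hA1S : A1 ≤ S := by
      rintro _ ⟨x, hx, rfl⟩
      rw [← hg, Sylow.smul_def]
      exact ⟨x, hAS' hx, rfl⟩
    have hPA1 : ¬ P ≤ A1 := fun h => hPA fun x hx => by
      obtain ⟨y, hy, hxy⟩ := h ((inferInstance : P.Normal).conj_mem x hx g)
      have : y = x := (MulAut.conj g).injective (by simpa using hxy)
      exact this ▸ hy
    obtain ⟨V, _, _, _, ρ, h1, h2, h3⟩ := exists_irr_acts_finrank_lt (A1.subgroupOf S) P'
      (fun h => hPA1 fun x hx => h (show (⟨x, hPS hx⟩ : S) ∈ P' from hx))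
    have h4 := hmin V ρ h1 h2
    obtain ⟨k, hk⟩ := hS.index (A1.subgroupOf S)
    have h5 : p * d ∣ (A1.subgroupOf S).index := by
      rw [hk, hdj]
      refine mul_dvd_pow_of_lt hpp ?_
      rw [← hk, ← hdj]; omega
    have h6 : Nat.card (A1.subgroupOf S) = Nat.card A := by
      rw [← hcard]
      exact Nat.card_congr (Subgroup.subgroupOfEquivOfLe hA1S).toEquiv
    have h7 := Subgroup.card_mul_index (A1.subgroupOf S)
    have h8 : Nat.card S ∣ Nat.card G := Subgroup.card_subgroup_dvd_card S.toSubgroup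
    refine Dvd.dvd.trans ?_ h8
    rw [← h7, h6, mul_comm (Nat.card A)]
    exact mul_dvd_mul_right h5 _

/-- All irreducible representations of `G` nontrivial on `N` have degree in `D`. -/
def DegreesIn (G : Type) [Group G] (N : Subgroup G) (D : Set ℕ) : Prop :=
  ∀ (V : Type) [AddCommGroup V] [Module ℂ V] [FiniteDimensional ℂ V] (ρ : Representation ℂ G V),
    IsIrr ρ → Acts ρ N → Module.finrank ℂ V ∈ D

omit [Finite G] in
lemma DegreesIn.mono {N M : Subgroup G} {D : Set ℕ} (h : DegreesIn G N D) (hM : M ≤ N) :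
    DegreesIn G M D := fun V _ _ _ ρ h1 h2 => h V ρ h1 (h2.mono hM)

omit [Finite G] in
lemma DegreesIn.minDegree {N : Subgroup G} {a b : ℕ} (h : DegreesIn G N {a, b}) (hab : a ≤ b) :
    MinDegree G N a := fun V _ _ _ ρ h1 h2 => by
  rcases h V ρ h1 h2 with h | h
  · exact h.ge
  · rw [Set.mem_singleton_iff] at h; omega

lemma exists_irr_acts {P : Subgroup G} (hP : P ≠ ⊥) :
    ∃ (V : Type) (_ : AddCommGroup V) (_ : Module ℂ V) (_ : FiniteDimensional ℂ V)
      (ρ : Representation ℂ G V), IsIrr ρ ∧ Acts ρ P := by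
  obtain ⟨x, hx, hx1⟩ := P.bot_or_exists_ne_one.resolve_left hP
  obtain ⟨V, _, _, _, ρ, h1, h2⟩ := exists_irr_ne_one hx1
  exact ⟨V, _, _, inferInstance, ρ, h1, x, hx, h2⟩

/-- A normal `p`-subgroup with at most two relative degrees is metabelian. -/
lemma metabelian_of_pGroup {p : ℕ} [Fact p.Prime] (P : Subgroup G) [P.Normal]
    (hp : IsPGroup p P) {a b : ℕ} (h : DegreesIn G P {a, b}) : ⁅⁅P, P⁆, ⁅P, P⁆⁆ = ⊥ := by
  by_contra hne
  have hP1 : ⁅P, P⁆ ≤ P := Subgroup.commutator_le_left P P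
  have hP2 : ⁅⁅P, P⁆, ⁅P, P⁆⁆ ≤ ⁅P, P⁆ := Subgroup.commutator_le_left _ _
  have hne1 : ⁅P, P⁆ ≠ ⊥ := fun h => hne (by rw [h]; exact Subgroup.commutator_bot_left _)
  have hne0 : P ≠ ⊥ := fun h => hne1 (by rw [h]; exact Subgroup.commutator_bot_left _)
  obtain ⟨d, ha, ⟨V0, _, _, _, ρ0, h1, h2, h3⟩, -⟩ := dvd_card_of_sylow P hne0 hp
  obtain ⟨d', ha', ⟨V1, _, _, _, ρ1, h1', h2', h3'⟩, -⟩ := dvd_card_of_sylow ⁅P, P⁆ hne1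
    (hp.to_le hP1)
  obtain ⟨V2, _, _, _, ρ2, h4, h5⟩ := exists_irr_acts hne
  have e0 := h V0 ρ0 h1 h2
  have e1 := h V1 ρ1 h1' (h2'.mono hP1)
  have e2 := h V2 ρ2 h4 (h5.mono (hP2.trans hP1))
  have f1 := ha V1 ρ1 h1' h2'
  have f2 := ha V2 ρ2 h4 (h5.mono hP2)
  have f3 := ha' V2 ρ2 h4 h5
  simp only [Set.mem_insert_iff, Set.mem_singleton_iff] at e0 e1 e2
  have n1 : Module.finrank ℂ V0 ≠ Module.finrank ℂ V1 := fun h => h3 (h ▸ f1)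
  have n2 : Module.finrank ℂ V0 ≠ Module.finrank ℂ V2 := fun h => h3 (h ▸ f2)
  have n3 : Module.finrank ℂ V1 ≠ Module.finrank ℂ V2 := fun h => h3' (h ▸ f3)
  omega

end Sylow

section LinearCharacters

variable {G : Type} [Group G]

lemma exists_hom_ne_one_of_commutator_le [Finite G] {X : Subgroup G} (h : commutator G ≤ X) {y : G}
    (hy : y ∉ X) : ∃ μ : G →* ℂˣ, (∀ x ∈ X, μ x = 1) ∧ μ y ≠ 1 := by
  have hn : X.Normal := ⟨fun x hx g => by
    have := X.mul_mem (h (Subgroup.commutator_mem_commutator (Subgroup.mem_top g)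
      (Subgroup.mem_top x))) hx
    rwa [commutatorElement_def, inv_mul_cancel_right] at this⟩
  have hc := Subgroup.Normal.quotient_commutative_iff_commutator_le.2 h
  let _ : CommGroup (G ⧸ X) := { mul_comm := hc.is_comm.comm }
  obtain ⟨φ, hφ⟩ := CommGroup.exists_apply_ne_one_of_hasEnoughRootsOfUnity (G ⧸ X) ℂ
    (a := (y : G ⧸ X)) (by rwa [Ne, QuotientGroup.eq_one_iff])
  refine ⟨φ.comp (QuotientGroup.mk' X), fun x hx => ?_, hφ⟩
  rw [MonoidHom.comp_apply, QuotientGroup.mk'_apply, (QuotientGroup.eq_one_iff x).2 hx, map_one]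

lemma exists_hom_ne_one [Finite G] {X Y : Subgroup G} (h : ⁅Y, Y⁆ ≤ X) (y : Y)
    (hyX : (y : G) ∉ X) : ∃ μ : Y →* ℂˣ, (∀ x : Y, (x : G) ∈ X → μ x = 1) ∧ μ y ≠ 1 := by
  have h1 : commutator Y ≤ X.subgroupOf Y := by
    rw [Subgroup.subgroupOf, ← Subgroup.map_le_iff_le_comap, Subgroup.map_subtype_commutator]
    exact h
  obtain ⟨μ, h2, h3⟩ := exists_hom_ne_one_of_commutator_le h1 (y := y) hyX
  exact ⟨μ, fun x hx => h2 x hx, h3⟩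

/-- Compatible linear characters of `Y` and `S`, the first one `S`-invariant, glue. -/
lemma exists_hom_sup {Y S T : Subgroup G} [Y.Normal] (hY : Y ≤ T) (hS : S ≤ T) (hT : T ≤ Y ⊔ S)
    (μ : Y →* ℂˣ) (σ : S →* ℂˣ) (h : ∀ x (hy : x ∈ Y) (hs : x ∈ S), μ ⟨x, hy⟩ = σ ⟨x, hs⟩)
    (hinv : S ≤ inertia Y (charRep μ)) :
    ∃ τ : T →* ℂˣ, (∀ y : Y, τ ⟨y, hY y.2⟩ = μ y) ∧ ∀ s : S, τ ⟨s, hS s.2⟩ = σ s := by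
  have h1 : ∀ t : T, ∃ (y : Y) (s : S), (y : G) * s = t := fun t => by
    have := hT t.2
    rw [← SetLike.mem_coe, Subgroup.normal_mul, Set.mem_mul] at this
    obtain ⟨y, hy, s, hs, h⟩ := this
    exact ⟨⟨y, hy⟩, ⟨s, hs⟩, h⟩
  choose f g hfg using h1
  have h2 : ∀ (y y' : Y) (s s' : S), (y : G) * s = y' * s' → μ y * σ s = μ y' * σ s' := by
    intro y y' s s' he
    have h3 : ((y'⁻¹ * y : Y) : G) = (s' * s⁻¹ : S) := by
      rw [Subgroup.coe_mul, Subgroup.coe_mul, Subgroup.coe_inv, Subgroup.coe_inv,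
        eq_mul_inv_iff_mul_eq, mul_assoc, he, inv_mul_cancel_left]
    have h4 := h _ (y'⁻¹ * y).2 (h3 ▸ (s' * s⁻¹).2)
    have h5 : (⟨((y'⁻¹ * y : Y) : G), h3 ▸ (s' * s⁻¹).2⟩ : S) = s' * s⁻¹ := Subtype.ext h3
    rw [h5, Subtype.coe_eta, map_mul, map_mul, map_inv, map_inv, inv_mul_eq_iff_eq_mul,
      ← mul_assoc, eq_mul_inv_iff_mul_eq] at h4
    exact h4
  refine ⟨MonoidHom.mk' (fun t => μ (f t) * σ (g t)) fun t t' => ?_, fun y => ?_, fun s => ?_⟩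
  · have h3 := mem_inertia_charRep.1 (hinv (g t).2) (f t')
    rw [mul_mul_mul_comm, ← h3, ← map_mul, ← map_mul]
    refine h2 _ _ _ _ ?_
    rw [hfg, Subgroup.coe_mul, Subgroup.coe_mul, Subgroup.coe_mul, MulAut.conjNormal_apply,
      ← hfg t, ← hfg t']
    group
  · have := h2 (f ⟨y, hY y.2⟩) y (g ⟨y, hY y.2⟩) 1 (by rw [hfg]; simp)
    simpa using this
  · have := h2 (f ⟨s, hS s.2⟩) 1 (g ⟨s, hS s.2⟩) s (by rw [hfg]; simp)
    simpa using this

end LinearCharacters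

section Twist

variable {G : Type} [Group G] {V U : Type} [AddCommGroup V] [Module ℂ V]
  [AddCommGroup U] [Module ℂ U]

/-- The tensor product of a representation with a linear character. -/
def twist (ρ : Representation ℂ G V) (μ : G →* ℂˣ) : Representation ℂ G V where
  toFun g := (μ g : ℂ) • ρ g
  map_one' := by simp
  map_mul' g h := by
    rw [map_mul, map_mul, Units.val_mul, smul_mul_smul_comm]

lemma twist_apply (ρ : Representation ℂ G V) (μ : G →* ℂˣ) (g : G) (v : V) :
    twist ρ μ g v = (μ g : ℂ) • ρ g v := rfl

lemma IsIrr.twist {ρ : Representation ℂ G V} (h : IsIrr ρ) (μ : G →* ℂˣ) :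
    IsIrr (twist ρ μ) := by
  refine ⟨h.1, fun W hW => h.2 W fun g w hw => ?_⟩
  have := W.smul_mem ((μ g)⁻¹ : ℂˣ).1 (hW g w hw)
  rwa [twist_apply, smul_smul, ← Units.val_mul, inv_mul_cancel, Units.val_one, one_smul] at this

end Twist

section Extension

variable {G : Type} [Group G] {V U : Type} [AddCommGroup V] [Module ℂ V]
  [AddCommGroup U] [Module ℂ U]

lemma IsIrr.comp_of_surjective {H : Type} [Group H] {ρ : Representation ℂ G V} (h : IsIrr ρ)
    {φ : H →* G} (hφ : Function.Surjective φ) : IsIrr (ρ.comp φ) := by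
  refine ⟨h.1, fun W hW => h.2 W fun g w hw => ?_⟩
  obtain ⟨x, rfl⟩ := hφ g
  exact hW x w hw

lemma exists_hom_of_weight [Finite G] {ρ : Representation ℂ G V} {μ : G →* ℂˣ} {v : V}
    (h0 : v ≠ 0) (hv : ∀ g, ρ g v = (μ g : ℂ) • v) :
    ∃ f : V →ₗ[ℂ] ℂ, IsEquiv ρ (charRep μ) f ∧ f v = 1 := by
  obtain ⟨f0, hf0⟩ := Module.Projective.exists_dual_ne_zero ℂ h0
  obtain ⟨F, hF, h1, -⟩ := exists_average ρ (charRep μ) ((f0 v)⁻¹ • f0)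
  refine ⟨F, hF, h1 v 1 fun g => ?_⟩
  rw [hv, charRep_apply, map_smul, LinearMap.smul_apply, map_inv]
  simp [hf0]

lemma exists_irr_over [Finite G] [FiniteDimensional ℂ U] (H : Subgroup G)
    {σ : Representation ℂ H U} (hσ : IsIrr σ) :
    ∃ (V : Type) (_ : AddCommGroup V) (_ : Module ℂ V) (_ : FiniteDimensional ℂ V)
      (ρ : Representation ℂ G V), IsIrr ρ ∧ ∃ s : U →ₗ[ℂ] V, IsEquiv σ (ρ.comp H.subtype) s ∧
        ∃ f : V →ₗ[ℂ] U, IsEquiv (ρ.comp H.subtype) σ f ∧ ∀ u, f (s u) = u := by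
  have := hσ.1
  have h0 : (⊤ : Submodule ℂ (coindV H σ)) ≠ ⊥ := by
    intro h
    have h2 := finrank_coind H σ
    rw [← finrank_top ℂ (coindV H σ), h, finrank_bot] at h2
    have := H.index_ne_zero_of_finite
    have : Module.finrank ℂ U ≠ 0 := Module.finrank_pos.ne'
    simp_all
  obtain ⟨B, -, hB⟩ := exists_isIrrSub (isInv_top (coindRep H σ)) h0
  have hf0 := evalOne_comp_ne_zero H σ hB.1 hB.2.1
  let f : B →ₗ[ℂ] U := evalOne H σ ∘ₗ B.subtype
  have hf : IsEquiv (V := B) ((subRep (coindRep H σ) B hB.1).comp H.subtype) σ f :=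
    fun h b => evalOne_isEquiv H σ h (b : coindV H σ)
  obtain ⟨s, hs, hs'⟩ := exists_section hf (hσ.surjective hf hf0)
  exact ⟨B, _, _, inferInstance, _, hB.isIrr, s, hs, _, hf, hs'⟩

/-- If `μ` extends to its inertia group `T` and all irreducible representations lying over `μ`
have degree `b`, then `T` has index `b`, and `T ⧸ X` is abelian. -/
lemma index_eq_and_commutator_le [Finite G] {X T : Subgroup G} [X.Normal] (hX : X ≤ T)
    (μ : X →* ℂˣ) (hT : T = inertia X (charRep μ)) (τ : T →* ℂˣ)
    (hτ : ∀ x : X, τ ⟨x, hX x.2⟩ = μ x) {b : ℕ}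
    (hb : ∀ (V : Type) [AddCommGroup V] [Module ℂ V] [FiniteDimensional ℂ V]
      (ρ : Representation ℂ G V), IsIrr ρ → HasWeight ρ X μ → Module.finrank ℂ V = b) :
    T.index = b ∧ ⁅T, T⁆ ≤ X := by
  have key : ∀ (U : Type) [AddCommGroup U] [Module ℂ U] [FiniteDimensional ℂ U]
      (σ : Representation ℂ T U), IsIrr σ → (∀ x : X, σ ⟨x, hX x.2⟩ = 1) →
      b ≤ T.index * Module.finrank ℂ U ∧ ∃ n, b = T.index * n ∧ Module.finrank ℂ U ≤ n := by
    intro U _ _ _ σ hσ h1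
    have hσ' := hσ.twist τ
    have := hσ.1
    obtain ⟨V, _, _, _, ρ, hρ, s, hs, f, hf, hfs⟩ := exists_irr_over T hσ'
    obtain ⟨u, hu⟩ := exists_ne (0 : U)
    have hsi : Function.Injective s := Function.LeftInverse.injective hfs
    have hw : ∀ (u : U) (x : X), ρ x (s u) = (μ x : ℂ) • s u := fun u x => by
      have := hs ⟨x, hX x.2⟩ u
      rw [twist_apply, h1, hτ, map_smul] at this
      exact this.symm
    have hsu : s u ≠ 0 := fun h => hu (hsi (h.trans (map_zero s).symm))
    have hVb := hb V ρ hρ ⟨s u, hsu, hw u⟩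
    have hf0 : f ≠ 0 := fun h => hu (by rw [← hfs u, h, LinearMap.zero_apply])
    refine ⟨hVb ▸ finrank_le_of_hom (H := T) hρ hf hf0,
      Module.finrank ℂ (isotypic ρ (charRep μ)), ?_, ?_⟩
    · rw [hT, ← hVb]
      exact finrank_eq_index_mul hρ (charRep_isIrr μ) (toSpanSingleton_isEquiv (hw u))
        fun h => hsu (by simpa using LinearMap.congr_fun h 1)
    · refine LinearMap.finrank_le_finrank_of_injective (f := s.codRestrict _ fun w => ?_) ?_
      · have := mem_isotypic (toSpanSingleton_isEquiv (hw w)) (1 : ℂ)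
        simpa using this
      · exact fun v w h => hsi (congrArg Subtype.val h)
  have hpos : 0 < T.index := Nat.pos_of_ne_zero T.index_ne_zero_of_finite
  have hindex : T.index = b := by
    obtain ⟨h1, n, h2, h3⟩ := key ℂ (charRep 1) (charRep_isIrr 1) fun x => by ext; simp
    rw [Module.finrank_self] at h1 h3
    nlinarith
  refine ⟨hindex, Subgroup.commutator_le.2 fun x hx y hy => ?_⟩
  by_contra hc
  have hn : (X.subgroupOf T).Normal := inferInstance
  have hne : ((⁅(⟨x, hx⟩ : T), (⟨y, hy⟩ : T)⁆ : T) : T ⧸ X.subgroupOf T) ≠ 1 := by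
    rw [Ne, QuotientGroup.eq_one_iff]; exact hc
  obtain ⟨U, _, _, _, σ, h1, h2⟩ := exists_irr_ne_one hne
  have h3 : IsIrr (σ.comp (QuotientGroup.mk' (X.subgroupOf T))) :=
    h1.comp_of_surjective (QuotientGroup.mk'_surjective _)
  obtain ⟨-, n, h4, h5⟩ := key U _ h3 fun x => by
    rw [MonoidHom.comp_apply, QuotientGroup.mk'_apply, (QuotientGroup.eq_one_iff _).2, map_one]
    exact x.2
  have h6 : n = 1 := by
    rw [hindex] at h4 hpos
    exact (Nat.mul_eq_left hpos.ne').1 h4.symm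
  have := h1.1
  have h7 : Module.finrank ℂ U = 1 := by
    have : 0 < Module.finrank ℂ U := Module.finrank_pos
    omega
  apply h2
  ext v
  rw [detChar_smul h7 σ]
  have h8 : detChar σ ((⁅(⟨x, hx⟩ : T), (⟨y, hy⟩ : T)⁆ : T) : T ⧸ X.subgroupOf T) = 1 := by
    exact (map_commutatorElement ((detChar σ).comp (QuotientGroup.mk' (X.subgroupOf T)))
      ⟨x, hx⟩ ⟨y, hy⟩).trans (commutatorElement_eq_one_iff_commute.2 (Commute.all _ _))
  rw [h8, Units.val_one, one_smul, Module.End.one_apply]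

end Extension

section Lifting

/-- A partial section over a normal `p`-subgroup of index prime to `p` extends to a section. -/
lemma exists_section_of_coprime {Γ N : Type} [Group Γ] [Finite Γ] [Group N] {p : ℕ}
    [Fact p.Prime] {f : Γ →* N} (hf : Function.Surjective f) (P : Subgroup N) [P.Normal]
    (hP : p.Coprime P.index) (φ : P →* Γ) (hφ : ∀ x, f (φ x) = x) (hn : φ.range.Normal)
    (hA : IsPGroup p (P.comap f)) :
    ∃ s : N →* Γ, (∀ n, f (s n) = n) ∧ ∀ x : P, s x = φ x := by
  obtain ⟨k, hk⟩ := IsPGroup.iff_card.1 hA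
  have hco : Nat.Coprime (Nat.card (P.comap f)) (P.comap f).index := by
    rw [hk, Subgroup.index_comap_of_surjective P hf]
    exact hP.pow_left k
  obtain ⟨H, hH⟩ := Subgroup.exists_right_complement'_of_coprime hco
  let L := φ.range ⊔ H
  have hφL : ∀ x, φ x ∈ L := fun x => le_sup_left (a := φ.range) ⟨x, rfl⟩
  have hbij : Function.Bijective (f.comp L.subtype) := by
    constructor
    · rw [injective_iff_map_eq_one]
      rintro ⟨l, hl⟩ h1
      change f l = 1 at h1
      have hl' := hl
      rw [← SetLike.mem_coe, Subgroup.normal_mul, Set.mem_mul] at hl'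
      obtain ⟨_, ⟨x, rfl⟩, h, hh, rfl⟩ := hl'
      rw [map_mul, hφ] at h1
      have h2 : h ∈ P.comap f ⊓ H := ⟨by
        change f h ∈ P
        rw [← inv_eq_of_mul_eq_one_right h1]
        exact P.inv_mem x.2, hh⟩
      rw [hH.disjoint.eq_bot, Subgroup.mem_bot] at h2
      subst h2
      rw [map_one, mul_one] at h1
      have : x = 1 := Subtype.ext h1
      simp [this]
    · intro n
      obtain ⟨γ, rfl⟩ := hf n
      have h1 : γ ∈ P.comap f ⊔ H := by rw [hH.sup_eq_top]; trivial
      rw [← SetLike.mem_coe, Subgroup.normal_mul, Set.mem_mul] at h1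
      obtain ⟨x, hx, h, hh, rfl⟩ := h1
      refine ⟨⟨φ ⟨f x, hx⟩ * h, L.mul_mem (hφL _) (le_sup_right (a := φ.range) hh)⟩, ?_⟩
      change f (φ ⟨f x, hx⟩ * h) = _
      rw [map_mul, map_mul, hφ]
  let e := MulEquiv.ofBijective _ hbij
  refine ⟨L.subtype.comp e.symm.toMonoidHom, fun n => e.apply_symm_apply n, fun x => ?_⟩
  have : e.symm x = ⟨φ x, hφL x⟩ := by
    rw [MulEquiv.symm_apply_eq]
    exact (hφ x).symm
  exact congrArg Subtype.val this

variable {N U : Type} [Group N] [AddCommGroup U] [Module ℂ U] [FiniteDimensional ℂ U]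

/-- The determinant as a homomorphism to `ℂˣ`. -/
noncomputable def unitsDet : (Module.End ℂ U)ˣ →* ℂˣ := Units.map LinearMap.det

/-- Pairs `(n, A)` with `A` an intertwiner of `σ` and its translate by `n`, normalized by
`det A ^ m = 1`. -/
def projectiveLift (P : Subgroup N) [P.Normal] (σ : Representation ℂ P U) (m : ℕ) :
    Subgroup (N × (Module.End ℂ U)ˣ) where
  carrier := {γ | (∀ x, γ.2 * σ.toHomUnits x = σ.toHomUnits (MulAut.conjNormal γ.1 x) * γ.2) ∧
    unitsDet γ.2 ^ m = 1}
  mul_mem' := by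
    rintro ⟨n, A⟩ ⟨n', B⟩ ⟨h1, h2⟩ ⟨h3, h4⟩
    refine ⟨fun x => ?_, ?_⟩
    · change A * B * _ = _ * (A * B)
      rw [mul_assoc, h3 x, ← mul_assoc, h1, mul_assoc]
      change _ = σ.toHomUnits (MulAut.conjNormal (n * n') x) * _
      rw [map_mul]; rfl
    · change unitsDet (A * B) ^ m = 1
      rw [map_mul, mul_pow, h2, h4, one_mul]
  one_mem' := by simp
  inv_mem' := by
    rintro ⟨n, A⟩ ⟨h1, h2⟩
    refine ⟨fun x => ?_, ?_⟩
    · change A⁻¹ * _ = σ.toHomUnits (MulAut.conjNormal n⁻¹ x) * A⁻¹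
      have := h1 (MulAut.conjNormal n⁻¹ x)
      rw [← MulAut.mul_apply, ← map_mul, mul_inv_cancel, map_one, MulAut.one_apply] at this
      rw [inv_mul_eq_iff_eq_mul, ← mul_assoc, this, mul_inv_cancel_right]
    · change unitsDet A⁻¹ ^ m = 1
      rw [map_inv, inv_pow, h2, inv_one]

variable {P : Subgroup N} [P.Normal] {σ : Representation ℂ P U}

lemma exists_unit_smul_of_mem_projectiveLift (hσ : IsIrr σ) {m : ℕ} {A : (Module.End ℂ U)ˣ}
    (h : (1, A) ∈ projectiveLift P σ m) :
    ∃ c : ℂˣ, (∀ v, (A : Module.End ℂ U) v = (c : ℂ) • v) ∧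
      c ^ (Module.finrank ℂ U * m) = 1 := by
  have := hσ.1
  obtain ⟨c, hc⟩ := hσ.schur (f := (A : Module.End ℂ U)) fun x v => by
    have h1 := congrArg Units.val (h.1 x)
    rw [map_one, MulAut.one_apply] at h1
    exact LinearMap.congr_fun h1 v
  have hA : (A : Module.End ℂ U) = c • 1 := LinearMap.ext hc
  have h2 : (c ^ Module.finrank ℂ U) ^ m = 1 := by
    have h3 := congrArg Units.val h.2
    rw [Units.val_pow_eq_pow_val] at h3
    change LinearMap.det (A : Module.End ℂ U) ^ m = 1 at h3
    rwa [hA, LinearMap.det_smul, map_one, mul_one] at h3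
  rw [← pow_mul] at h2
  have hc0 : c ≠ 0 := by
    rintro rfl
    obtain ⟨u, hu⟩ := exists_ne (0 : U)
    have h3 : ((A⁻¹ * A : (Module.End ℂ U)ˣ) : Module.End ℂ U) u = 0 := by
      rw [Units.val_mul, Module.End.mul_apply, hc, zero_smul, map_zero]
    rw [inv_mul_cancel, Units.val_one] at h3
    exact hu h3
  exact ⟨Units.mk0 c hc0, hc, Units.ext h2⟩

/-- An invariant irreducible representation of `p`-power degree of a normal `p`-subgroup of index
prime to `p` extends. -/
lemma exists_extension [Finite N] {p k : ℕ} [Fact p.Prime] (hP : p.Coprime P.index)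
    (hp : IsPGroup p P) (hσ : IsIrr σ) (hk : Module.finrank ℂ U = p ^ k) (hinv : inertia P σ = ⊤) :
    ∃ ν : Representation ℂ N U, ∀ x : P, ν x = σ x := by
  have hU := hσ.1
  set m := Nat.card P with hm
  obtain ⟨j, hj⟩ := IsPGroup.iff_card.1 hp
  have hdm : Module.finrank ℂ U * m ≠ 0 := mul_ne_zero Module.finrank_pos.ne' Nat.card_pos.ne'
  let f : projectiveLift P σ m →* N := (MonoidHom.fst _ _).comp (projectiveLift P σ m).subtype
  have hf : Function.Surjective f := by
    intro n
    obtain ⟨A, hA, hA'⟩ := (hinv ▸ Subgroup.mem_top n : n ∈ inertia P σ)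
    obtain ⟨u, hu⟩ := (Module.End.isUnit_iff A).2 hA
    have hd0 : (unitsDet u ^ m)⁻¹.1 ≠ 0 := Units.ne_zero _
    obtain ⟨c, hc⟩ := IsAlgClosed.exists_pow_nat_eq (unitsDet u ^ m)⁻¹.1 (Nat.pos_of_ne_zero hdm)
    have hc0 : c ≠ 0 := by
      rintro rfl
      rw [zero_pow hdm] at hc
      exact hd0 hc.symm
    let z : (Module.End ℂ U)ˣ :=
      Units.map (algebraMap ℂ (Module.End ℂ U)).toMonoidHom (Units.mk0 c hc0)
    have hz : unitsDet z = Units.mk0 c hc0 ^ Module.finrank ℂ U := by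
      refine Units.ext ?_
      change LinearMap.det (algebraMap ℂ (Module.End ℂ U) c) = _
      rw [Algebra.algebraMap_eq_smul_one, LinearMap.det_smul, map_one, mul_one]; rfl
    refine ⟨⟨(n, z * u), fun x => Units.ext (LinearMap.ext fun v => ?_), ?_⟩, rfl⟩
    · change c • u.1 (σ x v) = σ (MulAut.conjNormal n x) (c • u.1 v)
      rw [hu, hA', map_smul]
    · change unitsDet (z * u) ^ m = 1
      rw [map_mul, mul_pow, hz, ← pow_mul, ← eq_inv_iff_mul_eq_one]
      exact Units.ext hc
  have hfin : Finite (projectiveLift P σ m) := by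
    rw [f.finite_iff_finite_ker_range]
    refine ⟨?_, inferInstance⟩
    have h1 : ∀ γ : f.ker, ∃ c : ℂˣ, (∀ v, (γ.1.1.2 : Module.End ℂ U) v = (c : ℂ) • v) ∧
        c ^ (Module.finrank ℂ U * m) = 1 := by
      rintro ⟨⟨⟨n, A⟩, h⟩, hn⟩
      obtain rfl : n = 1 := hn
      exact exists_unit_smul_of_mem_projectiveLift hσ h
    choose g hg hg' using h1
    have : NeZero (Module.finrank ℂ U * m) := ⟨hdm⟩
    refine Finite.of_injective
      (fun γ => (⟨g γ, hg' γ⟩ : rootsOfUnity (Module.finrank ℂ U * m) ℂ)) fun γ δ h => ?_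
    have h2 : g γ = g δ := congrArg Subtype.val h
    refine Subtype.ext (Subtype.ext (Prod.ext (γ.2.trans δ.2.symm) ?_))
    exact Units.ext (LinearMap.ext fun v => by rw [hg, hg, h2])
  have hφ : ∀ x, P.subtype.prod σ.toHomUnits x ∈ projectiveLift P σ m := fun x => by
    refine ⟨fun y => ?_, ?_⟩
    · change σ.toHomUnits x * σ.toHomUnits y = σ.toHomUnits _ * σ.toHomUnits x
      rw [← map_mul, ← map_mul]
      congr 1
      exact Subtype.ext (by simp [MulAut.conjNormal_apply])
    · change unitsDet (σ.toHomUnits x) ^ m = 1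
      rw [← map_pow, ← map_pow, hm, pow_card_eq_one', map_one, map_one]
  let φ : P →* projectiveLift P σ m := MonoidHom.codRestrict (P.subtype.prod σ.toHomUnits) _ hφ
  have hn : φ.range.Normal := by
    constructor
    rintro _ ⟨x, rfl⟩ ⟨⟨n, A⟩, h⟩
    refine ⟨MulAut.conjNormal n x, Subtype.ext (Prod.ext ?_ ?_)⟩
    · exact MulAut.conjNormal_apply n x
    · change _ = A * σ.toHomUnits x * A⁻¹
      rw [eq_mul_inv_iff_mul_eq, h.1 x]
      rfl
  have hpg : IsPGroup p (P.comap f) := by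
    rintro ⟨γ, hγ⟩
    let x : P := ⟨f γ, hγ⟩
    refine ⟨j + (k + j), ?_⟩
    have h1 : ((γ * (φ x)⁻¹).1).1 = 1 := mul_inv_cancel (f γ)
    obtain ⟨c, hc, hc'⟩ := exists_unit_smul_of_mem_projectiveLift hσ (m := m)
      (A := (γ * (φ x)⁻¹).1.2) (by rw [← h1]; exact (γ * (φ x)⁻¹).2)
    set B := (γ * (φ x)⁻¹).1.2 with hB
    have hγB : γ.1.2 = B * σ.toHomUnits x := by
      rw [hB]
      exact (inv_mul_cancel_right γ.1.2 (σ.toHomUnits x)).symm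
    have hcomm : Commute B (σ.toHomUnits x) := by
      refine Units.ext (LinearMap.ext fun v => ?_)
      change B.1 (σ x v) = σ x (B.1 v)
      rw [hc, hc, map_smul]
    have hBpow : ∀ n : ℕ, ∀ v, (B ^ n).1 v = (c ^ n : ℂˣ).1 • v := fun n => by
      induction n with
      | zero => intro v; simp
      | succ n ih =>
        intro v
        rw [pow_succ, Units.val_mul, Module.End.mul_apply, hc, map_smul, ih, smul_smul, pow_succ',
          Units.val_mul]
    have hxm : x ^ m = 1 := pow_card_eq_one'
    have he : p ^ (j + (k + j)) = m * (Module.finrank ℂ U * m) := by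
      rw [pow_add, pow_add, ← hk, hm, hj]
    refine Subtype.ext (Subtype.ext (Prod.ext ?_ ?_))
    · change f γ ^ p ^ (j + (k + j)) = 1
      rw [he, pow_mul]
      have : f γ ^ m = 1 := congrArg Subtype.val hxm
      rw [this, one_pow]
    · change γ.1.2 ^ p ^ (j + (k + j)) = 1
      rw [hγB, hcomm.mul_pow, he, pow_mul (σ.toHomUnits x), ← map_pow, hxm, map_one, one_pow,
        mul_one, mul_comm m, pow_mul]
      have : B ^ (Module.finrank ℂ U * m) = 1 :=
        Units.ext (LinearMap.ext fun v => by rw [hBpow, hc']; simp)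
      rw [this, one_pow]
  obtain ⟨s, -, hs⟩ := exists_section_of_coprime hf P hP φ (fun _ => rfl) hn hpg
  refine ⟨(Units.coeHom _).comp ((MonoidHom.snd _ _).comp
    ((projectiveLift P σ m).subtype.comp s)), fun x => ?_⟩
  change ((s x).1.2 : Module.End ℂ U) = _
  rw [hs]
  rfl

end Lifting

section Characters

variable {G : Type} [Group G] [Finite G] {V : Type} [AddCommGroup V] [Module ℂ V]
  [FiniteDimensional ℂ V]

lemma IsIrr.simple {ρ : Representation ℂ G V} (h : IsIrr ρ) : Simple (FDRep.of ρ) := by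
  have := h.1
  rw [FDRep.simple_iff_end_is_rank_one,
    ← (Representation.linHom.invariantsEquivFDRepHom (FDRep.of ρ) (FDRep.of ρ)).finrank_eq]
  have key : ∀ f : V →ₗ[ℂ] V, f ∈ (Representation.linHom ρ ρ).invariants ↔ IsEquiv ρ ρ f := by
    intro f
    rw [Representation.mem_invariants]
    constructor
    · intro hf g v
      have h1 := LinearMap.congr_fun (hf g) (ρ g v)
      rw [Representation.linHom_apply, LinearMap.comp_apply, LinearMap.comp_apply,
        rho_inv_self] at h1
      exact h1.symm
    · intro hf g
      ext v
      rw [Representation.linHom_apply, LinearMap.comp_apply, LinearMap.comp_apply, hf,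
        rho_self_inv]
  change Module.finrank ℂ (Representation.linHom ρ ρ).invariants = 1
  refine _root_.finrank_eq_one ⟨LinearMap.id, (key _).2 fun _ _ => rfl⟩ (fun h0 => ?_) fun f => ?_
  · obtain ⟨v, hv⟩ := exists_ne (0 : V)
    exact hv (LinearMap.congr_fun (congrArg Subtype.val h0) v)
  · obtain ⟨c, hc⟩ := h.schur ((key f.1).1 f.2)
    exact ⟨c, Subtype.ext (LinearMap.ext fun v => (hc v).symm)⟩

lemma eq_one_of_character_eq {ρ : Representation ℂ G V}
    (h : ∀ g, ρ.character g = ρ.character 1) : ρ = 1 := by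
  cases nonempty_fintype G
  have hG : (Nat.card G : ℂ) ≠ 0 := by exact_mod_cast Nat.card_pos.ne'
  have := invertibleOfNonzero hG
  have h1 := Representation.card_inv_mul_sum_char_eq_finrank ρ
  simp only [h] at h1
  rw [Finset.sum_const, Finset.card_univ, ← Nat.card_eq_fintype_card, nsmul_eq_mul,
    inv_mul_cancel_left₀ hG, Representation.char_one, Nat.cast_inj] at h1
  have h2 := Submodule.eq_top_of_finrank_eq h1.symm
  ext g v
  have : v ∈ ρ.invariants := h2 ▸ Submodule.mem_top
  exact (Representation.mem_invariants ρ v).1 this g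

lemma degreesIn_cdOver (N : Subgroup G) : DegreesIn G N (cdOver G N) := by
  intro V _ _ _ ρ hρ hN
  refine ⟨FDRep.of ρ, hρ.simple, fun h => ?_, rfl⟩
  obtain ⟨n, hn, hn1⟩ := hN
  have h1 : ρ.comp N.subtype = 1 := eq_one_of_character_eq fun g =>
    (h g g.2).trans (congrArg (FDRep.of ρ).character N.coe_one.symm)
  exact hn1 (DFunLike.congr_fun h1 ⟨n, hn⟩)

omit [Finite G] in
/-- Degrees of the representations of a quotient. -/
lemma DegreesIn.map_mk {N : Subgroup G} {D : Set ℕ} (h : DegreesIn G N D) (X : Subgroup G)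
    [X.Normal] : DegreesIn (G ⧸ X) (N.map (QuotientGroup.mk' X)) D := by
  rintro V _ _ _ ρ hρ ⟨_, ⟨n, hn, rfl⟩, h1⟩
  exact h V _ (hρ.comp_of_surjective (QuotientGroup.mk'_surjective X)) ⟨n, hn, h1⟩

end Characters

section SylowSubgroups

variable {G : Type} [Group G]

lemma commutator_le_iff_le_comap {A C X : Subgroup G} [X.Normal] : ⁅A, C⁆ ≤ X ↔
    A ≤ (Subgroup.centralizer (C.map (QuotientGroup.mk' X) : Set (G ⧸ X))).comap
      (QuotientGroup.mk' X) := by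
  rw [← Subgroup.map_le_iff_le_comap, ← Subgroup.commutator_eq_bot_iff_le_centralizer,
    ← Subgroup.map_commutator, Subgroup.map_eq_bot_iff, QuotientGroup.ker_mk']

lemma sup_commutator_le {A B C X : Subgroup G} [X.Normal] (hA : ⁅A, C⁆ ≤ X) (hB : ⁅B, C⁆ ≤ X) :
    ⁅A ⊔ B, C⁆ ≤ X := by
  rw [commutator_le_iff_le_comap] at *
  exact sup_le hA hB

/-- `Q` is a Sylow `q`-subgroup of the subgroup `Y`. -/
structure IsSylowOf (q : ℕ) (Q Y : Subgroup G) : Prop where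
  le : Q ≤ Y
  isPGroup : IsPGroup q Q
  not_dvd : ¬ q ∣ Q.relIndex Y

variable {q : ℕ} [Fact q.Prime]

lemma exists_isSylowOf [Finite G] (q : ℕ) [Fact q.Prime] (Y : Subgroup G) :
    ∃ Q, IsSylowOf q Q Y := by
  obtain ⟨Q⟩ : Nonempty (Sylow q Y) := inferInstance
  refine ⟨Q.toSubgroup.map Y.subtype, Subgroup.map_subtype_le _, Q.2.map _, ?_⟩
  rw [Subgroup.relIndex, Subgroup.subgroupOf, Subgroup.comap_map_eq_self_of_injective
    Y.subtype_injective]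
  exact Q.not_dvd_index

lemma exists_isSylowOf_le [Finite G] {R Y : Subgroup G} (hR : R ≤ Y) (h : IsPGroup q R) :
    ∃ Q, IsSylowOf q Q Y ∧ R ≤ Q := by
  obtain ⟨Q, hQ⟩ := (h.comap_subtype (K := Y)).exists_le_sylow
  refine ⟨Q.toSubgroup.map Y.subtype, ⟨Subgroup.map_subtype_le _, Q.2.map _, ?_⟩, ?_⟩
  · rw [Subgroup.relIndex, Subgroup.subgroupOf, Subgroup.comap_map_eq_self_of_injective
      Y.subtype_injective]
    exact Q.not_dvd_index
  · exact fun x hx => ⟨⟨x, hR hx⟩, hQ hx, rfl⟩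

omit [Fact q.Prime] in
lemma IsSylowOf.mono [Finite G] {Q X Y : Subgroup G} (h : IsSylowOf q Q Y) (hQ : Q ≤ X)
    (hX : X ≤ Y) : IsSylowOf q Q X :=
  ⟨hQ, h.isPGroup, fun hd => h.not_dvd (hd.trans
    (Dvd.intro _ (Subgroup.relIndex_mul_relIndex Q X Y hQ hX)))⟩

lemma IsSylowOf.normalizer_sup_eq_top [Finite G] {Q Y : Subgroup G} [Y.Normal]
    (h : IsSylowOf q Q Y) : Subgroup.normalizer (Q : Set G) ⊔ Y = ⊤ := by
  have h1 : IsPGroup q (Q.subgroupOf Y) := h.isPGroup.comap_subtype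
  have h2 := Sylow.normalizer_sup_eq_top (h1.toSylow h.not_dvd)
  change Subgroup.normalizer (((Q.subgroupOf Y).map Y.subtype : Subgroup G) : Set G) ⊔ Y = ⊤ at h2
  rwa [Subgroup.subgroupOf_map_subtype, inf_of_le_left h.le] at h2

/-- A normal Sylow subgroup contains all `q`-subgroups. -/
lemma IsSylowOf.le_of_isPGroup [Finite G] {Q Y R : Subgroup G} (h : IsSylowOf q Q Y)
    (hn : Y ≤ Subgroup.normalizer (Q : Set G)) (hR : R ≤ Y) (hR' : IsPGroup q R) : R ≤ Q := by
  have := Subgroup.normal_subgroupOf_of_le_normalizer hn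
  obtain ⟨j, hj⟩ := IsPGroup.iff_card.1 hR'
  have h1 : Q.relIndex R ∣ Q.relIndex Y := by
    rw [← Subgroup.relIndex_subgroupOf hR]
    exact Subgroup.relIndex_dvd_index_of_normal _ _
  obtain ⟨i, -, hi⟩ := (Nat.dvd_prime_pow (Fact.out : q.Prime)).1
    (hj ▸ Subgroup.relIndex_dvd_card Q R)
  rw [← Subgroup.relIndex_eq_one, hi]
  rcases i with _ | i
  · rfl
  · exact absurd ((Dvd.intro_left _ (pow_succ q i).symm).trans (hi ▸ h1)) h.not_dvd

lemma IsSylowOf.sup_normal [Finite G] {Q X Y : Subgroup G} [X.Normal] [Y.Normal]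
    (h : IsSylowOf q Q Y) (hn : Y ≤ Subgroup.normalizer ((X ⊔ Q : Subgroup G) : Set G)) :
    (X ⊔ Q).Normal := by
  rw [← Subgroup.normalizer_eq_top_iff, eq_top_iff, ← h.normalizer_sup_eq_top]
  refine sup_le (le_trans ?_ (Subgroup.normalizer_inf_normalizer_le_normalizer_sup X Q)) hn
  rw [Subgroup.normalizer_eq_top (H := X), top_inf_eq]

lemma IsSylowOf.sup_normalizer_eq_top [Finite G] {Q X Y : Subgroup G} [X.Normal] [Y.Normal]
    (h : IsSylowOf q Q Y) (hX : X ≤ Y)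
    (hn : Y ≤ Subgroup.normalizer ((X ⊔ Q : Subgroup G) : Set G)) :
    X ⊔ Subgroup.normalizer (Q : Set G) = ⊤ := by
  have := h.sup_normal hn
  rw [eq_top_iff, ← (h.mono le_sup_right (sup_le hX h.le)).normalizer_sup_eq_top]
  exact sup_le le_sup_right (sup_le le_sup_left (Subgroup.le_normalizer.trans le_sup_right))

/-- A normal subgroup of a `p`-group of operators has nontrivial coinvariants. -/
lemma eq_bot_of_le_commutator [Finite G] {P S : Subgroup G} (hS : IsPGroup q S) (hP : P ≤ S)
    (h : P ≤ ⁅P, S⁆) : P = ⊥ := by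
  have h1 : ∀ n, P ≤ S.lowerCentralSeries n := by
    intro n
    induction n with
    | zero => exact hP
    | succ n ih => exact h.trans (Subgroup.commutator_mono ih le_rfl)
  obtain ⟨n, hn⟩ := (Subgroup.isNilpotent_iff_lowerCentralSeries S).1 hS.isNilpotent
  exact le_bot_iff.1 (hn ▸ h1 n)

lemma exists_invariant_hom [Finite G] {P E S : Subgroup G} [P.Normal] [E.Normal]
    (hS : IsPGroup q S) (hPS : P ≤ S) (hE : E ≤ P) (hne : E ≠ P) (hPE : ⁅P, P⁆ ≤ E) :
    ∃ μ : P →* ℂˣ, μ ≠ 1 ∧ (∀ x : P, (x : G) ∈ E → μ x = 1) ∧ S ≤ inertia P (charRep μ) := by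
  have h1 : ¬ P ≤ E ⊔ ⁅P, S⁆ := by
    intro h
    have h2 : P.map (QuotientGroup.mk' E) = ⊥ := by
      refine eq_bot_of_le_commutator (hS.map (QuotientGroup.mk' E)) (Subgroup.map_mono hPS) ?_
      refine (Subgroup.map_mono h).trans ?_
      rw [Subgroup.map_sup, Subgroup.map_commutator, QuotientGroup.map_mk'_self, bot_sup_eq]
    rw [Subgroup.map_eq_bot_iff, QuotientGroup.ker_mk'] at h2
    exact hne (le_antisymm hE h2)
  obtain ⟨x, hx, hx'⟩ := SetLike.not_le_iff_exists.1 h1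
  obtain ⟨μ, h2, h3⟩ := exists_hom_ne_one (hPE.trans le_sup_left) ⟨x, hx⟩ hx'
  refine ⟨μ, fun h => h3 (by rw [h]; rfl), fun x hx => h2 x (le_sup_left (a := E) hx), fun s hs => ?_⟩
  rw [mem_inertia_charRep]
  intro k
  have h4 : μ (MulAut.conjNormal s k * k⁻¹) = 1 := by
    refine h2 _ (le_sup_right (a := E) ?_)
    rw [Subgroup.coe_mul, MulAut.conjNormal_apply, Subgroup.coe_inv, Subgroup.commutator_comm]
    exact Subgroup.commutator_mem_commutator hs k.2
  rwa [map_mul, map_inv, mul_inv_eq_one] at h4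

/-- If the normal `p`-subgroup `P` contains `⁅N, N⁆`, is a Sylow subgroup of `N` and is centralized
modulo `X` by `N`, then `N ⧸ X` is abelian. -/
lemma commutator_le_of_central [Finite G] {P N X : Subgroup G} [X.Normal] [P.Normal]
    (hP : IsSylowOf q P N) (hN : ⁅N, N⁆ ≤ P) (h : ⁅P, N⁆ ≤ X) : ⁅N, N⁆ ≤ X := by
  have hcop : Nat.Coprime (Nat.card (P.subgroupOf N)) (P.subgroupOf N).index := by
    obtain ⟨j, hj⟩ := IsPGroup.iff_card.1 (hP.isPGroup.comap_subtype (K := N))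
    rw [Subgroup.subgroupOf, hj]
    exact Nat.Coprime.pow_left _ ((Nat.Prime.coprime_iff_not_dvd Fact.out).2 hP.not_dvd)
  obtain ⟨H, hH⟩ := Subgroup.exists_right_complement'_of_coprime hcop
  have hN' : N = P ⊔ H.map N.subtype := by
    have h1 := congrArg (Subgroup.map N.subtype) hH.sup_eq_top
    rw [Subgroup.map_sup, Subgroup.subgroupOf_map_subtype, inf_of_le_left hP.le,
      ← MonoidHom.range_eq_map, Subgroup.range_subtype] at h1
    exact h1.symm
  have hHH : ⁅H.map N.subtype, H.map N.subtype⁆ ≤ X := by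
    rw [← Subgroup.map_commutator]
    suffices ⁅H, H⁆ = ⊥ by rw [this, Subgroup.map_bot]; exact bot_le
    refine le_bot_iff.1 (le_trans (le_inf ?_ (Subgroup.commutator_le_self H)) hH.disjoint.le_bot)
    rw [Subgroup.subgroupOf, ← Subgroup.map_le_iff_le_comap, Subgroup.map_commutator]
    exact le_trans (Subgroup.commutator_mono (Subgroup.map_subtype_le _)
      (Subgroup.map_subtype_le _)) hN
  have hHN : ⁅H.map N.subtype, N⁆ ≤ X := by
    rw [Subgroup.commutator_comm]
    nth_rw 1 [hN']
    refine sup_commutator_le ?_ hHH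
    exact le_trans (Subgroup.commutator_mono le_rfl (Subgroup.map_subtype_le _)) h
  nth_rw 1 [hN']
  exact sup_commutator_le h hHN

lemma le_of_forall_isSylowOf [Finite G] {C N : Subgroup G}
    (h : ∀ (q : ℕ) [Fact q.Prime], ∃ Q ≤ C, IsSylowOf q Q N) : N ≤ C := by
  rw [← Subgroup.relIndex_eq_one]
  by_contra hne
  obtain ⟨q, hq, hd⟩ := Nat.exists_prime_and_dvd hne
  have : Fact q.Prime := ⟨hq⟩
  obtain ⟨Q, h1, h2⟩ := h q
  exact h2.not_dvd (hd.trans (Subgroup.relIndex_dvd_of_le_left N h1))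

end SylowSubgroups

section TwoDegrees

variable {G : Type} [Group G] [Finite G] {N : Subgroup G} [N.Normal] {a b : ℕ}

/-- A weight of a character of minimal degree is trivial on commutators. -/
lemma weight_eq_one (ha : MinDegree G N a) {V : Type} [AddCommGroup V] [Module ℂ V]
    [FiniteDimensional ℂ V] {ρ : Representation ℂ G V} (hρ : IsIrr ρ)
    (hV : Module.finrank ℂ V ≤ a) {X : Subgroup G} [X.Normal] {μ : X →* ℂˣ} (h : HasWeight ρ X μ)
    {x : X} (hx : (x : G) ∈ ⁅X, N⁆) : μ x = 1 := by
  obtain ⟨v, h0, hv⟩ := h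
  have h1 : ¬ Acts ρ ⁅X, N⁆ := by
    refine not_acts_commutator_of_weight hρ h0 hv ?_
    exact le_inertia_of_weight ha hρ hV h0 hv
  have h2 := hv x
  rw [not_acts_iff.1 h1 x hx, Module.End.one_apply] at h2
  have h3 : ((1 : ℂ) - (μ x : ℂ)) • v = 0 := by rw [sub_smul, one_smul, ← h2, sub_self]
  rw [smul_eq_zero, or_iff_left h0, sub_eq_zero] at h3
  exact Units.ext h3.symm

lemma DegreesIn.finrank_eq_of_weight (hD : DegreesIn G N {a, b}) (hab : a < b) {V : Type}
    [AddCommGroup V] [Module ℂ V] [FiniteDimensional ℂ V] {ρ : Representation ℂ G V}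
    (hρ : IsIrr ρ) {X : Subgroup G} [X.Normal] (hX : X ≤ N) {μ : X →* ℂˣ} (h : HasWeight ρ X μ)
    {x : X} (hx : (x : G) ∈ ⁅X, N⁆) (hx' : μ x ≠ 1) : Module.finrank ℂ V = b := by
  rcases hD V ρ hρ ((h.acts hx').mono hX) with h1 | h1
  · exact absurd (weight_eq_one (hD.minDegree hab.le) hρ h1.le h hx) hx'
  · exact h1

/-- If `μ` extends to its stabilizer `T` then the index of `T` is the large degree. -/
lemma DegreesIn.index_inertia (hD : DegreesIn G N {a, b}) (hab : a < b) {X S : Subgroup G}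
    [X.Normal] (hX : X ≤ N) {μ : X →* ℂˣ} {x : X} (hx : (x : G) ∈ ⁅X, N⁆) (hx' : μ x ≠ 1)
    (hS : inertia X (charRep μ) = X ⊔ S) (hXS : ∀ x : X, (x : G) ∈ S → μ x = 1) :
    (inertia X (charRep μ)).index = b ∧
      ⁅inertia X (charRep μ), inertia X (charRep μ)⁆ ≤ X := by
  have hST : S ≤ inertia X (charRep μ) := hS ▸ le_sup_right
  obtain ⟨τ, hτ, -⟩ := exists_hom_sup (le_inertia (charRep μ)) hST hS.le μ 1
    (fun x hy hs => hXS ⟨x, hy⟩ hs) hST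
  exact index_eq_and_commutator_le (le_inertia _) μ rfl τ hτ
    fun V _ _ _ ρ hρ h => hD.finrank_eq_of_weight hab hρ hX h hx hx'

omit [N.Normal] in
lemma exists_isSylowOf_not_commutator_le {p : ℕ} [Fact p.Prime] {P : Subgroup G} [P.Normal]
    (hP : IsSylowOf p P N) (hNP : ⁅N, N⁆ ≤ P) (hD : DegreesIn G N {a, b})
    (hM : ⁅⁅N, N⁆, ⁅N, N⁆⁆ ≠ ⊥) :
    ∃ (q : ℕ) (_ : Fact q.Prime) (Q : Subgroup G), IsSylowOf q Q N ∧ ¬ ⁅P, Q⁆ ≤ ⁅P, P⁆ := by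
  by_contra! h
  have h1 := le_of_forall_isSylowOf (N := N) (C := (Subgroup.centralizer
    (P.map (QuotientGroup.mk' ⁅P, P⁆) : Set (G ⧸ ⁅P, P⁆))).comap (QuotientGroup.mk' ⁅P, P⁆))
    fun q hq => by
      obtain ⟨Q, hQ⟩ := exists_isSylowOf q N
      refine ⟨Q, commutator_le_iff_le_comap.1 ?_, hQ⟩
      rw [Subgroup.commutator_comm]
      exact h q hq Q hQ
  rw [← commutator_le_iff_le_comap, Subgroup.commutator_comm] at h1
  have h2 := commutator_le_of_central hP hNP h1
  exact hM (le_bot_iff.1 ((Subgroup.commutator_mono h2 h2).trans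
    (metabelian_of_pGroup P hP.isPGroup (hD.mono hP.le)).le))

lemma exists_stabilizer_of_sylow {p : ℕ} [Fact p.Prime] {P : Subgroup G} [P.Normal]
    (hP : IsSylowOf p P N) (hNP : ⁅N, N⁆ ≤ P) (hD : DegreesIn G N {a, b}) (hab : a < b)
    (hM : ⁅⁅N, N⁆, ⁅N, N⁆⁆ ≠ ⊥) :
    ∃ T : Subgroup G, P ≤ T ∧ T.index = b ∧ ⁅T, T⁆ ≤ P ∧ ¬ p ∣ b ∧ ¬ N ≤ T := by
  obtain ⟨q, hq, Q, hQ, hPQ⟩ := exists_isSylowOf_not_commutator_le hP hNP hD hM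
  have hn1 : N ≤ Subgroup.normalizer ((P ⊔ Q : Subgroup G) : Set G) :=
    Subgroup.le_normalizer_iff_commutator_le_right.2
      ((Subgroup.commutator_mono le_rfl (sup_le hP.le hQ.le)).trans (hNP.trans le_sup_left))
  have hN1 : (P ⊔ Q).Normal := hQ.sup_normal hn1
  have hPL := hQ.sup_normalizer_eq_top hP.le hn1
  set L := Subgroup.normalizer (Q : Set G) with hL
  set B := ⁅P, P ⊔ Q⁆ with hB
  have hBP : B ≤ P := Subgroup.commutator_le_left _ _
  have hQ1 : IsSylowOf q Q (P ⊔ Q) := hQ.mono le_sup_right (sup_le hP.le hQ.le)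
  have hBL : B ⊔ L = ⊤ := by
    refine hQ1.sup_normalizer_eq_top (hBP.trans le_sup_left) (sup_le ?_ ?_)
    · refine Subgroup.le_normalizer_iff_commutator_le_right.2
        (le_trans (Subgroup.commutator_mono le_rfl ?_) le_sup_left)
      exact sup_le_sup_right hBP Q
    · exact le_sup_right.trans Subgroup.le_normalizer
  have hPB : P ≤ B ⊔ (P ⊓ L) := by
    intro x hx
    obtain ⟨y, hy, z, hz, rfl⟩ := Subgroup.mem_sup_of_normal_left.1 (hBL ▸ Subgroup.mem_top x : x ∈ B ⊔ L)
    refine Subgroup.mul_mem_sup hy ⟨?_, hz⟩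
    exact (Subgroup.mul_mem_cancel_left P (hBP hy)).1 hx
  set E := ⁅P, P⁆ ⊔ (P ⊓ L) with hE
  have hEP : E ≤ P := sup_le (Subgroup.commutator_le_left _ _) inf_le_left
  have hLP : L ≤ Subgroup.normalizer ((P ⊓ L : Subgroup G) : Set G) := by
    refine Subgroup.le_normalizer_iff_commutator_le_right.2 (le_inf ?_ ?_)
    · exact (Subgroup.commutator_mono le_rfl inf_le_left).trans (Subgroup.commutator_le_right _ _)
    · exact (Subgroup.commutator_mono le_rfl inf_le_right).trans (Subgroup.commutator_le_self _)
  have hEn : E.Normal := by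
    rw [← Subgroup.normalizer_eq_top_iff, eq_top_iff, ← hPL]
    refine sup_le ?_ (le_trans ?_ (Subgroup.normalizer_inf_normalizer_le_normalizer_sup _ _))
    · exact Subgroup.le_normalizer_iff_commutator_le_right.2
        ((Subgroup.commutator_mono le_rfl hEP).trans le_sup_left)
    · rw [Subgroup.normalizer_eq_top (H := ⁅P, P⁆), top_inf_eq]
      exact hLP
  have hPLQ : ⁅P ⊓ L, Q⁆ = ⊥ ∨ ⁅P, Q⁆ ≤ ⁅P, P⁆ := by
    by_cases hqp : q = p
    · subst hqp
      exact Or.inr (Subgroup.commutator_mono le_rfl (hP.le_of_isPGroup Subgroup.le_normalizer_of_normal hQ.le hQ.isPGroup))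
    · left
      refine le_bot_iff.1 ((le_inf ?_ ?_ : _ ≤ P ⊓ Q).trans ?_)
      · exact (Subgroup.commutator_mono inf_le_left le_rfl).trans (Subgroup.commutator_le_left _ _)
      · exact (Subgroup.commutator_mono inf_le_right le_rfl).trans
          (Subgroup.le_normalizer_iff_commutator_le_right.1 le_rfl)
      · exact (IsPGroup.disjoint_of_ne p q (Ne.symm hqp) P Q hP.isPGroup hQ.isPGroup).le_bot
  have hEne : E ≠ P := by
    intro h
    refine hPQ (hPLQ.elim (fun h1 => ?_) id)
    have : ⁅⁅P, P⁆ ⊔ (P ⊓ L), Q⁆ ≤ ⁅P, P⁆ :=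
      sup_commutator_le (Subgroup.commutator_le_left _ _) (h1.le.trans bot_le)
    rwa [← hE, h] at this
  obtain ⟨S⟩ : Nonempty (Sylow p G) := inferInstance
  have hPS : P ≤ S := hP.isPGroup.le_sylow_of_normal S
  obtain ⟨μ, h1, h2, h3⟩ := exists_invariant_hom S.2 hPS hEP hEne le_sup_left
  have hμ : ∃ x : P, (x : G) ∈ ⁅P, N⁆ ∧ μ x ≠ 1 := by
    by_contra! h
    apply h1
    ext x
    have hk : P ≤ (μ.ker).map P.subtype := by
      refine hPB.trans (sup_le (fun y hy => ?_) (fun y hy => ?_))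
      · exact ⟨⟨y, hBP hy⟩, h ⟨y, hBP hy⟩
          (Subgroup.commutator_mono le_rfl (sup_le hP.le hQ.le) hy), rfl⟩
      · exact ⟨⟨y, hy.1⟩, h2 _ (le_sup_right (a := ⁅P, P⁆) hy), rfl⟩
    obtain ⟨y, hy, hyx⟩ := hk x.2
    rw [← Subtype.ext hyx, MonoidHom.mem_ker.1 hy, MonoidHom.one_apply]
  obtain ⟨x, hx, hx'⟩ := hμ
  have hT : inertia P (charRep μ) = P ⊔ (L ⊓ inertia P (charRep μ)) := by
    refine le_antisymm (fun t ht => ?_) (sup_le (le_inertia _) inf_le_right)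
    obtain ⟨y, hy, z, hz, rfl⟩ := Subgroup.mem_sup_of_normal_left.1 (hPL ▸ Subgroup.mem_top t : t ∈ P ⊔ L)
    exact Subgroup.mul_mem_sup hy
      ⟨hz, (Subgroup.mul_mem_cancel_left _ (le_inertia (charRep μ) hy)).1 ht⟩
  obtain ⟨h4, h5⟩ := hD.index_inertia hab hP.le hx hx' hT
    fun x hx => h2 x (le_sup_right (a := ⁅P, P⁆) ⟨x.2, hx.1⟩)
  refine ⟨inertia P (charRep μ), le_inertia _, h4, h5, fun h => ?_, fun h => ?_⟩
  · exact S.not_dvd_index ((h4 ▸ h).trans (Subgroup.index_dvd_of_le h3))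
  · have h6 : ∀ y ∈ ⁅P, N⁆, y ∈ (μ.ker).map P.subtype := by
      refine Subgroup.commutator_le.2 fun y hy n hn => ?_
      have h7 := mem_inertia_charRep.1 (h hn) ⟨y, hy⟩⁻¹
      refine ⟨⟨y, hy⟩ * MulAut.conjNormal n ⟨y, hy⟩⁻¹, ?_, ?_⟩
      · rw [SetLike.mem_coe, MonoidHom.mem_ker, map_mul, h7, map_inv, mul_inv_cancel]
      · simp [commutatorElement_def, mul_assoc]
    obtain ⟨y, hy, hyx⟩ := h6 x hx
    exact hx' (by rw [← Subtype.ext hyx]; exact hy)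

/-- The `N ⊓ T`-invariants produce a linear character of `T` below an irreducible character. -/
lemma finrank_lt_index_of_weight {T : Subgroup G} (hT : ⁅T, T⁆ ≤ N) {μ : N →* ℂˣ} {n : N}
    (hn : μ n ≠ 1) (hμ : ∀ x : N, (x : G) ∈ T → μ x = 1) {V : Type} [AddCommGroup V] [Module ℂ V]
    [FiniteDimensional ℂ V] {ρ : Representation ℂ G V} (hρ : IsIrr ρ) (h : HasWeight ρ N μ) :
    Module.finrank ℂ V < T.index := by
  have hN := h.acts hn
  obtain ⟨v, h0, hv⟩ := h
  let A : Submodule ℂ V :=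
    { carrier := {w | ∀ x ∈ T, x ∈ N → ρ x w = w}
      add_mem' := fun {c d} hc hd x hx hx' => by rw [map_add, hc x hx hx', hd x hx hx']
      zero_mem' := fun x _ _ => map_zero _
      smul_mem' := fun c d hd x hx hx' => by rw [map_smul, hd x hx hx'] }
  have hA : IsInv (ρ.comp T.subtype) A := by
    intro t w hw x hx hx'
    have h1 := hw ((t : G)⁻¹ * x * t) (T.mul_mem (T.mul_mem (T.inv_mem t.2) hx) t.2)
      (by simpa using ‹N.Normal›.conj_mem x hx' (t : G)⁻¹)
    change ρ x (ρ t w) = ρ t w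
    nth_rw 2 [← h1]
    rw [← Module.End.mul_apply, ← Module.End.mul_apply, ← map_mul, ← map_mul]
    congr 2
    group
  have hA0 : A ≠ ⊥ := by
    refine Submodule.ne_bot_iff _ |>.2 ⟨v, fun x hx hx' => ?_, h0⟩
    rw [hv ⟨x, hx'⟩, hμ ⟨x, hx'⟩ hx, Units.val_one, one_smul]
  obtain ⟨B, hBA, hB⟩ := exists_isIrrSub hA hA0
  have hB1 : Module.finrank ℂ B = 1 := by
    refine hB.isIrr.finrank_eq_one fun x y => ?_
    have h2 : subRep (ρ.comp T.subtype) B hB.1 ⁅x, y⁆ = 1 := by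
      ext w
      exact hBA w.2 _ (⁅x, y⁆ : T).2 (hT (Subgroup.commutator_mem_commutator x.2 y.2))
    rw [← map_mul, ← map_mul, show x * y = ⁅x, y⁆ * (y * x) by simp [commutatorElement_def, mul_assoc],
      map_mul, h2, one_mul]
  have := hB.isIrr.1
  obtain ⟨w, hw⟩ := exists_ne (0 : B)
  set σ := detChar (subRep (ρ.comp T.subtype) B hB.1) with hσ
  have hw' : ∀ t : T, ρ.comp T.subtype t (w : V) = (σ t : ℂ) • (w : V) := fun t =>
    congrArg Subtype.val (detChar_smul hB1 (subRep (ρ.comp T.subtype) B hB.1) t w)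
  have hw0 : (w : V) ≠ 0 := fun h => hw (Subtype.ext h)
  obtain ⟨f, hf, hf1⟩ := exists_hom_of_weight hw0 hw'
  refine finrank_lt_index_of_hom T N σ (fun t ht => ?_) hρ hN hf
    (fun h => by rw [h, LinearMap.zero_apply] at hf1; exact zero_ne_one hf1)
  have h3 := hw' t
  rw [show ρ.comp T.subtype t (w : V) = w from hBA w.2 t t.2 ht] at h3
  have h4 : ((1 : ℂ) - (σ t : ℂ)) • (w : V) = 0 := by rw [sub_smul, one_smul, ← h3, sub_self]
  rw [smul_eq_zero, or_iff_left hw0, sub_eq_zero] at h4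
  exact Units.ext h4.symm

/-- If all irreducible constituents over an extendible `μ` have degree `a`, then `a` divides the
index of the domain of the extension. -/
lemma dvd_index_of_weight {S : Subgroup G} {μ : N →* ℂˣ}
    (ha : ∀ (V : Type) [AddCommGroup V] [Module ℂ V] [FiniteDimensional ℂ V]
      (ρ : Representation ℂ G V), IsIrr ρ → HasWeight ρ N μ → Module.finrank ℂ V = a)
    (hS : S ≤ inertia N (charRep μ)) (hNS : ∀ x : N, (x : G) ∈ S → μ x = 1) : a ∣ S.index := by
  obtain ⟨τ, hτ, -⟩ := exists_hom_sup (T := N ⊔ S) le_sup_left le_sup_right le_rfl μ 1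
    (fun x hy hs => hNS ⟨x, hy⟩ hs) hS
  refine dvd_trans ?_ (Subgroup.index_dvd_of_le (le_sup_right : S ≤ N ⊔ S))
  have h1 := finrank_coind (N ⊔ S) (charRep τ)
  rw [Module.finrank_self, mul_one] at h1
  rw [← h1, ← finrank_top ℂ (coindV (N ⊔ S) (charRep τ))]
  refine dvd_finrank (isInv_top (coindRep (N ⊔ S) (charRep τ))) fun B _ hB => ?_
  refine (ha B _ hB.isIrr ?_).symm.dvd
  have h2 : IsEquiv (V := B) (W := ℂ)
      ((subRep (coindRep (N ⊔ S) (charRep τ)) B hB.1).comp (N ⊔ S).subtype) (charRep τ)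
      (evalOne (N ⊔ S) (charRep τ) ∘ₗ B.subtype) := fun t v =>
    evalOne_isEquiv (N ⊔ S) (charRep τ) t v
  refine exists_eigenvector_of_hom (f := evalOne (N ⊔ S) (charRep τ) ∘ₗ B.subtype)
    (fun x v => ?_) (evalOne_comp_ne_zero _ _ hB.1 hB.2.1)
  have h3 := h2 ⟨x, le_sup_left (a := N) x.2⟩ v
  rw [charRep_apply, hτ x] at h3
  rw [charRep_apply]
  exact h3

end TwoDegrees

section Twist

variable {G : Type} [Group G] {U : Type} [AddCommGroup U] [Module ℂ U]

lemma detChar_twist (ρ : Representation ℂ G U) (μ : G →* ℂˣ) :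
    detChar (twist ρ μ) = μ ^ Module.finrank ℂ U * detChar ρ := by
  ext g
  have : twist ρ μ g = (μ g : ℂ) • ρ g := LinearMap.ext fun v => twist_apply ρ μ g v
  rw [detChar_coe, this, LinearMap.det_smul]
  simp

lemma inertia_le_inertia_detChar {K : Subgroup G} [K.Normal] (σ : Representation ℂ K U) (m : ℕ) :
    inertia K σ ≤ inertia K (charRep (detChar σ ^ m)) := by
  rintro g ⟨A, hA, hA'⟩
  rw [mem_inertia_charRep]
  intro k
  rw [MonoidHom.pow_apply, MonoidHom.pow_apply]
  congr 1
  ext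
  rw [detChar_coe, detChar_coe]
  let E := LinearEquiv.ofBijective A hA
  have h1 : σ (MulAut.conjNormal g k) = E.toLinearMap ∘ₗ σ k ∘ₗ E.symm.toLinearMap := by
    ext u
    have := hA' k (E.symm u)
    change _ = A (σ k (E.symm u))
    rw [this]
    congr 1
    exact (E.apply_symm_apply u).symm
  rw [h1, LinearMap.det_conj]

end Twist

section CommutatorPGroup

/-- A character whose kernel contains `P` has a root of any exponent prime to the index of `P`. -/
lemma exists_pow_eq_of_coprime {N : Type} [Group N] {P : Subgroup N} [P.Normal]
    {θ : N →* ℂˣ} (hθ : ∀ x ∈ P, θ x = 1) {m : ℕ} (hm : m.Coprime P.index) :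
    ∃ τ : N →* ℂˣ, (∀ x ∈ P, τ x = 1) ∧ τ ^ m = θ := by
  have h1 : θ ^ P.index = 1 := by
    ext x
    rw [MonoidHom.pow_apply, ← map_pow, hθ _ (P.pow_index_mem x), MonoidHom.one_apply]
  refine ⟨θ ^ (m.gcdA P.index), fun x hx => ?_, ?_⟩
  · rw [MonoidHom.zpow_apply, hθ x hx, one_zpow]
  · have h2 := Nat.gcd_eq_gcd_ab m P.index
    rw [hm] at h2
    ext g
    have h3 : (θ g) ^ P.index = 1 := by rw [← MonoidHom.pow_apply, h1, MonoidHom.one_apply]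
    rw [MonoidHom.pow_apply, MonoidHom.zpow_apply]
    congr 1
    calc (θ g ^ (m.gcdA P.index)) ^ m
        = θ g ^ ((m : ℤ) * m.gcdA P.index + P.index * m.gcdB P.index) := by
          rw [zpow_add, zpow_mul _ (P.index : ℤ), zpow_natCast _ P.index, h3, one_zpow, mul_one,
            mul_comm, zpow_mul, zpow_natCast]
      _ = θ g := by rw [← h2, Nat.cast_one, zpow_one]

variable {G : Type} [Group G] [Finite G] {N : Subgroup G} [N.Normal] {a b : ℕ}
  {p : ℕ} [Fact p.Prime] {P : Subgroup G} [P.Normal]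

/-- Extensions of an invariant character can be chosen with prescribed determinant. -/
lemma exists_extension_inertia_le (hP : IsSylowOf p P N) {U : Type} [AddCommGroup U] [Module ℂ U]
    [FiniteDimensional ℂ U] {σ : Representation ℂ P U} (hσ : IsIrr σ) {k : ℕ}
    (hk : Module.finrank ℂ U = p ^ k) (hinv : N ≤ inertia P σ) {μ : N →* ℂˣ}
    (hμ : ∀ x : N, (x : G) ∈ P → μ x = 1) :
    ∃ ν : Representation ℂ N U, (∀ x : P, ν ⟨x, hP.le x.2⟩ = σ x) ∧
      inertia N ν ≤ inertia N (charRep μ) := by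
  let e := Subgroup.subgroupOfEquivOfLe hP.le
  have hcop : p.Coprime (P.subgroupOf N).index :=
    (Nat.Prime.coprime_iff_not_dvd Fact.out).2 hP.not_dvd
  have hp : IsPGroup p (P.subgroupOf N) := hP.isPGroup.comap_subtype
  obtain ⟨ν, hν⟩ := exists_extension (σ := σ.comp e.toMonoidHom) hcop hp
    (hσ.comp_of_surjective e.surjective) hk <| by
      rw [eq_top_iff]
      intro n _
      obtain ⟨A, hA, hA'⟩ := hinv n.2
      refine ⟨A, hA, fun k u => ?_⟩
      have h1 : e (MulAut.conjNormal n k) = MulAut.conjNormal (n : G) (e k) := by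
        ext
        simp [e]
      change A (σ (e k) u) = σ (e _) (A u)
      rw [h1]
      exact hA' (e k) u
  have hν' : ∀ x : P, ν ⟨x, hP.le x.2⟩ = σ x := fun x => by
    rw [show (⟨x, hP.le x.2⟩ : N) = ((e.symm x : P.subgroupOf N) : N) from rfl, hν]
    change σ (e (e.symm x)) = _
    rw [e.apply_symm_apply]
  obtain ⟨j, hj⟩ := IsPGroup.iff_card.1 hP.isPGroup
  obtain ⟨τ, hτ, hτ'⟩ := exists_pow_eq_of_coprime (P := P.subgroupOf N) (m := p ^ k * p ^ j)
    (θ := μ * (detChar ν ^ (p ^ j))⁻¹) (fun x hx => by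
      have hx1 : x ^ p ^ j = 1 := by
        have := pow_card_eq_one' (x := (⟨x, hx⟩ : P))
        rw [hj] at this
        exact Subtype.ext (by simpa using congrArg Subtype.val this)
      rw [MonoidHom.mul_apply, hμ x hx, MonoidHom.inv_apply, MonoidHom.pow_apply, ← map_pow, hx1,
        map_one, inv_one, one_mul])
    (Nat.Coprime.mul_left (Nat.Coprime.pow_left _ hcop) (Nat.Coprime.pow_left _ hcop))
  refine ⟨twist ν τ, fun x => ?_, ?_⟩
  · ext v
    rw [twist_apply, hτ _ x.2, hν' x, Units.val_one, one_smul]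
  · have h2 : detChar (twist ν τ) ^ (p ^ j) = μ := by
      ext g
      have h3 := DFunLike.congr_fun hτ' g
      simp only [MonoidHom.mul_apply, MonoidHom.pow_apply, MonoidHom.inv_apply] at h3
      rw [detChar_twist, MonoidHom.pow_apply, MonoidHom.mul_apply, MonoidHom.pow_apply, mul_pow,
        ← pow_mul, hk, h3, inv_mul_cancel_right]
    have h3 := inertia_le_inertia_detChar (twist ν τ) (p ^ j)
    rwa [h2] at h3

omit [P.Normal] in
/-- An irreducible character acting nontrivially on `⁅P, P⁆` for a `p`-group `P` has an irreducible
constituent over `P` of degree divisible by `p`. -/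
lemma exists_irrSub_finrank_pow (hp : IsPGroup p P) {V : Type} [AddCommGroup V] [Module ℂ V]
    [FiniteDimensional ℂ V] {ρ : Representation ℂ G V} (hρ : Acts ρ ⁅P, P⁆) :
    ∃ B, ∃ hB : IsIrrSub (ρ.comp P.subtype) B, ∃ x : P, (x : G) ∈ ⁅P, P⁆ ∧
      subRep _ B hB.1 x ≠ 1 ∧ ∃ k, Module.finrank ℂ B = p ^ (k + 1) := by
  obtain ⟨x, hx, hx1⟩ := hρ
  obtain ⟨B, hB, h⟩ := exists_irrSub_acts (ρ := ρ.comp P.subtype)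
    (x := ⟨x, Subgroup.commutator_le_self P hx⟩) hx1
  refine ⟨B, hB, _, hx, h, ?_⟩
  obtain ⟨k, hk⟩ := exists_finrank_eq_pow P hp B _ hB.isIrr
  rcases k with _ | k
  · refine absurd ?_ h
    rw [pow_zero] at hk
    set σ := detChar (subRep (ρ.comp P.subtype) B hB.1)
    have h1 : ⟨x, Subgroup.commutator_le_self P hx⟩ ∈ commutator P := by
      have h2 : x ∈ (commutator P).map P.subtype := by
        rwa [Subgroup.map_subtype_commutator]
      obtain ⟨y, hy, rfl⟩ := h2
      exact hy
    have h3 := Abelianization.commutator_subset_ker σ h1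
    ext w
    rw [detChar_smul hk, MonoidHom.mem_ker.1 h3, Units.val_one, one_smul, Module.End.one_apply]
  · exact ⟨k, hk⟩

theorem commutator_eq_bot_of_isPGroup_commutator (hp : IsPGroup p (⁅N, N⁆ : Subgroup G))
    (hD : DegreesIn G N {a, b}) (hab : a < b) : ⁅⁅N, N⁆, ⁅N, N⁆⁆ = ⊥ := by
  by_contra hM
  obtain ⟨P, hP, hNP⟩ := exists_isSylowOf_le (Subgroup.commutator_le_self N) hp
  have hPn : P.Normal := by
    have := hP.sup_normal (X := ⁅N, N⁆) (Subgroup.le_normalizer_iff_commutator_le_right.2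
      ((Subgroup.commutator_mono le_rfl
        (sup_le (Subgroup.commutator_le_self N) hP.le)).trans le_sup_left))
    rwa [sup_of_le_right hNP] at this
  have hPP : ⁅P, P⁆ ≠ ⊥ := fun h => hM (le_bot_iff.1 (h ▸ Subgroup.commutator_mono hNP hNP))
  obtain ⟨T, hPT, hTb, hTP, hpb, hNT⟩ := exists_stabilizer_of_sylow hP hNP hD hab hM
  obtain ⟨n, hn, hnT⟩ := SetLike.not_le_iff_exists.1 hNT
  obtain ⟨μ, hμ, hμn⟩ := exists_hom_ne_one (hNP.trans hPT) ⟨n, hn⟩ hnT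
  have hμP : ∀ x : N, (x : G) ∈ P → μ x = 1 := fun x hx => hμ x (hPT hx)
  have hμa : ∀ (V : Type) [AddCommGroup V] [Module ℂ V] [FiniteDimensional ℂ V]
      (ρ : Representation ℂ G V), IsIrr ρ → HasWeight ρ N μ → Module.finrank ℂ V = a := by
    intro V _ _ _ ρ hρ h
    rcases hD V ρ hρ (h.acts hμn) with h1 | h1
    · exact h1
    · have := finrank_lt_index_of_weight (hTP.trans hP.le) hμn hμ hρ h
      rw [Set.mem_singleton_iff] at h1
      omega
  obtain ⟨S, hS⟩ := exists_isSylowOf p (inertia N (charRep μ))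
  have hS1 : a ∣ S.index := dvd_index_of_weight hμa hS.le fun x hx => by
    refine hμP x (hP.le_of_isPGroup (R := N ⊓ S)
      Subgroup.le_normalizer_of_normal inf_le_left (hS.isPGroup.to_le inf_le_right)
      ⟨x.2, hx⟩)
  rw [← Subgroup.relIndex_mul_index hS.le] at hS1
  have hPa : ∀ (V : Type) [AddCommGroup V] [Module ℂ V] [FiniteDimensional ℂ V]
      (ρ : Representation ℂ G V), IsIrr ρ → Acts ρ ⁅P, P⁆ → Module.finrank ℂ V = a := by
    intro V _ _ _ ρ hρ h
    obtain ⟨d, hd, -⟩ := dvd_card_of_sylow P (fun h => hPP (by rw [h, Subgroup.commutator_bot_left]))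
      hP.isPGroup
    rcases hD V ρ hρ (h.mono ((Subgroup.commutator_le_self P).trans hP.le)) with h1 | h1
    · exact h1
    · exact absurd (h1 ▸ (Dvd.intro _ rfl).trans (hd V ρ hρ h)) hpb
  obtain ⟨W, _, _, _, ψ, hψ, hψP⟩ := exists_irr_acts hPP
  obtain ⟨B, hB, x, hx, hBx, k, hk⟩ := exists_irrSub_finrank_pow hP.isPGroup hψP
  have hBN : N ≤ inertia P (subRep (ψ.comp P.subtype) B hB.1) :=
    le_inertia_of_minDegree (hD.minDegree hab.le) hψ (hPa W ψ hψ hψP).le hB.isIrr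
      (subtype_isEquiv _ B hB.1) (fun h => hB.2.1 (by
        rw [← B.range_subtype, h, LinearMap.range_zero]))
  obtain ⟨ν, hν, hνμ⟩ := exists_extension_inertia_le hP hB.isIrr hk hBN hμP
  have hνirr : IsIrr ν := ⟨hB.isIrr.1, fun A hA => hB.isIrr.2 A fun y w hw => by
    rw [← hν y]; exact hA _ w hw⟩
  obtain ⟨V, _, _, _, ρ, hρ, s, hs, f, hf, hfs⟩ := exists_irr_over N hνirr
  have hVP : Acts ρ ⁅P, P⁆ := by
    refine ⟨x, hx, fun h => hBx (LinearMap.ext fun w => ?_)⟩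
    rw [← hν x, ← hfs (ν _ w), hs]
    change f (ρ x (s w)) = w
    rw [h]
    exact hfs w
  have hs0 : s ≠ 0 := by
    rintro rfl
    have := hB.isIrr.1
    obtain ⟨w, hw⟩ := exists_ne (0 : B)
    exact hw (by simpa using (hfs w).symm)
  have h1 := index_mul_finrank_dvd hρ hνirr hs hs0 hνμ
  rw [hPa V ρ hρ hVP, hk] at h1
  have h2 := h1.trans hS1
  rw [mul_comm] at h2
  have h3 := Nat.dvd_of_mul_dvd_mul_right
    (Nat.pos_of_ne_zero Subgroup.index_ne_zero_of_finite) h2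
  exact hS.not_dvd ((dvd_pow_self p k.succ_ne_zero).trans h3)

end CommutatorPGroup

section Complement

variable {G : Type} [Group G]

lemma normal_of_le_normalizer {X A B : Subgroup G} (h : A ⊔ B = ⊤)
    (hA : A ≤ Subgroup.normalizer (X : Set G)) (hB : B ≤ Subgroup.normalizer (X : Set G)) :
    X.Normal := by
  rw [← Subgroup.normalizer_eq_top_iff, eq_top_iff, ← h]
  exact sup_le hA hB

lemma le_normalizer_of_commutator_eq_bot {X A : Subgroup G} (h : ⁅A, X⁆ = ⊥) :
    A ≤ Subgroup.normalizer (X : Set G) :=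
  Subgroup.le_normalizer_iff_commutator_le_right.2 (h ▸ bot_le)

lemma eq_bot_of_isPGroup_of_ne {p q : ℕ} [Fact p.Prime] [Fact q.Prime] (hpq : p ≠ q)
    {X : Subgroup G} (hp : IsPGroup p X) (hq : IsPGroup q X) : X = ⊥ :=
  disjoint_self.1 (IsPGroup.disjoint_of_ne p q hpq X X hp hq)

variable [Finite G]

lemma exists_isSylowOf_ne_bot {p : ℕ} [Fact p.Prime] {K : Subgroup G} (hK : ¬ IsPGroup p K) :
    ∃ (q : ℕ) (_ : Fact q.Prime) (Q : Subgroup G), p ≠ q ∧ IsSylowOf q Q K ∧ Q ≠ ⊥ := by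
  by_contra! h
  refine hK (IsPGroup.iff_card.2 ⟨_, Nat.eq_prime_pow_of_unique_prime_dvd Nat.card_pos.ne' ?_⟩)
  intro q hq hd
  have := Fact.mk hq
  obtain ⟨Q, hQ⟩ := exists_isSylowOf q K
  by_contra hne
  have h1 := hQ.not_dvd
  rw [h q this Q (Ne.symm hne) hQ, Subgroup.relIndex_bot_left] at h1
  exact h1 hd

lemma exists_complement {p : ℕ} [Fact p.Prime] {N K M : Subgroup G} [N.Normal] [K.Normal]
    [M.Normal] (hKN : K ≤ N) (hKK : ⁅K, K⁆ = M) (hMM : ⁅M, M⁆ = ⊥) (hM : M ≠ ⊥)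
    (hp : IsPGroup p M)
    (hmin : ∀ X : Subgroup G, X.Normal → X ≤ N → X ≠ ⊥ → M ≤ X) (hK : ¬ IsPGroup p K) :
    ∃ L, M ⊔ L = ⊤ ∧ M ⊓ L = ⊥ ∧ M ≤ ⁅M, N⁆ := by
  obtain ⟨q, hq, Q, hpq, hQ, hQ1⟩ := exists_isSylowOf_ne_bot hK
  have hMK : M ≤ K := hKK ▸ Subgroup.commutator_le_self K
  have hML : M ⊔ Subgroup.normalizer (Q : Set G) = ⊤ := by
    refine hQ.sup_normalizer_eq_top hMK (Subgroup.le_normalizer_iff_commutator_le_right.2 ?_)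
    exact ((Subgroup.commutator_mono le_rfl (sup_le hMK hQ.le)).trans hKK.le).trans le_sup_left
  have hnle : ¬ M ≤ Subgroup.normalizer (Q : Set G) := by
    intro h
    rw [sup_of_le_right h, Subgroup.normalizer_eq_top_iff] at hML
    exact hM (eq_bot_of_isPGroup_of_ne hpq hp
      (hQ.isPGroup.to_le (hmin Q hML (hQ.le.trans hKN) hQ1)))
  refine ⟨_, hML, ?_, ?_⟩
  · by_contra h
    refine hnle ((hmin _ ?_ (inf_le_left.trans (hMK.trans hKN)) h).trans inf_le_right)
    refine normal_of_le_normalizer hML (le_normalizer_of_commutator_eq_bot ?_) ?_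
    · exact le_bot_iff.1 (hMM ▸ Subgroup.commutator_mono le_rfl inf_le_left)
    · exact (le_inf Subgroup.le_normalizer_of_normal Subgroup.le_normalizer).trans
        Subgroup.inf_normalizer_le_normalizer_inf
  · refine hmin _ inferInstance (Subgroup.commutator_le_right _ _) fun h => hnle ?_
    refine le_normalizer_of_commutator_eq_bot (le_bot_iff.1 (h ▸ ?_))
    exact Subgroup.commutator_mono le_rfl (hQ.le.trans hKN)

end Complement

section NilpotentComplement

variable {G : Type} [Group G]

lemma le_normalizer_commutator {A B L : Subgroup G} (hA : L ≤ Subgroup.normalizer (A : Set G))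
    (hB : L ≤ Subgroup.normalizer (B : Set G)) :
    L ≤ Subgroup.normalizer ((⁅A, B⁆ : Subgroup G) : Set G) := by
  intro g hg
  rw [Subgroup.mem_normalizer_iff_map_conj_eq, Subgroup.map_commutator,
    Subgroup.mem_normalizer_iff_map_conj_eq.1 (hA hg),
    Subgroup.mem_normalizer_iff_map_conj_eq.1 (hB hg)]

variable [Finite G] {N K M L : Subgroup G} [M.Normal] {a b : ℕ}

lemma commutator_eq_bot_of_le_inertia {H : Subgroup G} (hMM : ⁅M, M⁆ = ⊥)
    (h : ∀ μ : M →* ℂˣ, μ ≠ 1 → H ≤ inertia M (charRep μ)) : ⁅H, M⁆ = ⊥ := by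
  rw [eq_bot_iff, Subgroup.commutator_le]
  intro x hx m hm
  by_contra h1
  let y : M := MulAut.conjNormal x ⟨m, hm⟩ * ⟨m, hm⟩⁻¹
  have hy : (y : G) = ⁅x, m⁆ := by
    simp [y, commutatorElement_def]
  obtain ⟨μ, -, hμ⟩ := exists_hom_ne_one hMM.le y (hy ▸ h1)
  refine hμ ?_
  have h2 := mem_inertia_charRep.1 (h μ (fun h3 => hμ (by rw [h3]; rfl)) hx) ⟨m, hm⟩
  rw [map_mul, map_inv, h2, mul_inv_cancel]

lemma index_inertia_of_complement [N.Normal] (hD : DegreesIn G N {a, b}) (hab : a < b)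
    (hML : M ⊔ L = ⊤) (hML' : M ⊓ L = ⊥) (hMN : M ≤ ⁅M, N⁆) {μ : M →* ℂˣ} (hμ : μ ≠ 1) :
    (inertia M (charRep μ)).index = b ∧
      ⁅inertia M (charRep μ), inertia M (charRep μ)⁆ ≤ M := by
  obtain ⟨x, hx⟩ : ∃ x, μ x ≠ 1 := by
    by_contra! h
    exact hμ (MonoidHom.ext h)
  refine hD.index_inertia hab (hMN.trans (Subgroup.commutator_le_right _ _)) (hMN x.2) hx
    (S := L ⊓ inertia M (charRep μ)) (le_antisymm (fun t ht => ?_) (sup_le (le_inertia _)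
      inf_le_right)) fun x hx => ?_
  · obtain ⟨m, hm, l, hl, rfl⟩ := Subgroup.mem_sup_of_normal_left.1 (hML ▸ Subgroup.mem_top t)
    exact Subgroup.mul_mem_sup hm ⟨hl, (Subgroup.mul_mem_cancel_left _
      (le_inertia _ hm)).1 ht⟩
  · have h1 : (x : G) ∈ M ⊓ L := ⟨x.2, hx.1⟩
    rw [hML', Subgroup.mem_bot] at h1
    rw [show x = 1 from Subtype.ext h1, map_one]

omit [M.Normal] in
lemma commutator_le_of_index [N.Normal] [K.Normal] (hD : DegreesIn G N {a, b}) (hab : a < b)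
    (hKN : K ≤ N) {T : Subgroup G} (hKT : ⁅K, K⁆ ≤ T) (hT : T.index = b) : ⁅K, N⁆ ≤ T := by
  by_contra h
  obtain ⟨y, hy, hyT⟩ := SetLike.not_le_iff_exists.1 h
  have hyK : y ∈ K := Subgroup.commutator_le_left _ _ hy
  obtain ⟨μ, h1, h2⟩ := exists_hom_ne_one hKT ⟨y, hyK⟩ hyT
  obtain ⟨V, _, _, _, ρ, hρ, hV, hlt⟩ := exists_irr_hasWeight_finrank_lt T K μ
    (fun h3 => h2 (by rw [h3]; rfl)) h1
  have := hD.finrank_eq_of_weight hab hρ hKN hV hy h2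
  omega

omit [Finite G] [M.Normal] in
lemma eq_bot_of_commutator_eq_bot (hM : M ≠ ⊥)
    (hmin : ∀ X : Subgroup G, X.Normal → X ≤ N → X ≠ ⊥ → M ≤ X)
    (hML : M ⊔ L = ⊤) (hML' : M ⊓ L = ⊥) {Z : Subgroup G} (hZN : Z ≤ N) (hZL : Z ≤ L)
    (hLZ : L ≤ Subgroup.normalizer (Z : Set G)) (hZM : ⁅Z, M⁆ = ⊥) : Z = ⊥ := by
  by_contra hZ
  refine hM (le_bot_iff.1 (hML' ▸ le_inf le_rfl ((hmin Z ?_ hZN hZ).trans hZL)))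
  rw [Subgroup.commutator_comm] at hZM
  exact normal_of_le_normalizer hML (le_normalizer_of_commutator_eq_bot hZM) hLZ

lemma commutator_inf_eq_bot [N.Normal] [K.Normal] (hD : DegreesIn G N {a, b}) (hab : a < b)
    (hKN : K ≤ N) (hKK : ⁅K, K⁆ = M) (hMM : ⁅M, M⁆ = ⊥) (hM : M ≠ ⊥)
    (hmin : ∀ X : Subgroup G, X.Normal → X ≤ N → X ≠ ⊥ → M ≤ X)
    (hML : M ⊔ L = ⊤) (hML' : M ⊓ L = ⊥) (hMN : M ≤ ⁅M, N⁆) : ⁅K ⊓ L, N ⊓ L⁆ = ⊥ := by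
  have hnorm : ∀ X : Subgroup G, X.Normal → L ≤ Subgroup.normalizer ((X ⊓ L : Subgroup G) : Set G) :=
    fun X _ => (le_inf Subgroup.le_normalizer_of_normal Subgroup.le_normalizer).trans
        Subgroup.inf_normalizer_le_normalizer_inf
  refine eq_bot_of_commutator_eq_bot hM hmin hML hML' ?_ ?_
    (le_normalizer_commutator (hnorm K ‹_›) (hnorm N ‹_›)) ?_
  · exact (Subgroup.commutator_mono inf_le_left inf_le_left).trans (Subgroup.commutator_le_right _ _)
  · exact (Subgroup.commutator_mono inf_le_right inf_le_right).trans (Subgroup.commutator_le_self _)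
  · refine commutator_eq_bot_of_le_inertia hMM fun μ hμ => ?_
    refine (Subgroup.commutator_mono inf_le_left inf_le_left).trans ?_
    exact commutator_le_of_index hD hab hKN (hKK.le.trans (le_inertia _))
      (index_inertia_of_complement hD hab hML hML' hMN hμ).1

/-- In a nilpotent group of class at most two, some Sylow subgroup of a nonabelian subgroup is
nonabelian. -/
lemma exists_isSylowOf_commutator_ne_bot {N₀ : Subgroup G} (h : ⁅⁅N₀, N₀⁆, N₀⁆ = ⊥)
    (h' : ⁅N₀, N₀⁆ ≠ ⊥) :
    ∃ (r : ℕ) (_ : Fact r.Prime) (R : Subgroup G), IsSylowOf r R N₀ ∧ ⁅R, R⁆ ≠ ⊥ ∧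
      N₀ ≤ Subgroup.normalizer (R : Set G) := by
  have hnil : Group.IsNilpotent N₀ :=
    (Subgroup.isNilpotent_iff_lowerCentralSeries N₀).2 ⟨2, h⟩
  have hn : ∀ r [Fact r.Prime] (R : Subgroup G), IsSylowOf r R N₀ →
      N₀ ≤ Subgroup.normalizer (R : Set G) := by
    intro r _ R hR
    have h1 : IsPGroup r (R.subgroupOf N₀) := hR.isPGroup.comap_subtype
    have h2 : (h1.toSylow hR.not_dvd : Subgroup N₀).Normal := inferInstance
    exact (Subgroup.normal_subgroupOf_iff_le_normalizer hR.le).1 h2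
  by_contra! hab
  refine h' (Subgroup.commutator_eq_bot_iff_le_centralizer.2 ?_)
  refine le_of_forall_isSylowOf fun q _ => ?_
  obtain ⟨Q, hQ⟩ := exists_isSylowOf q N₀
  refine ⟨Q, ?_, hQ⟩
  rw [← Subgroup.commutator_eq_bot_iff_le_centralizer, Subgroup.commutator_comm,
    Subgroup.commutator_eq_bot_iff_le_centralizer]
  refine le_of_forall_isSylowOf fun r _ => ?_
  obtain ⟨R, hR⟩ := exists_isSylowOf r N₀
  refine ⟨R, ?_, hR⟩
  rw [← Subgroup.commutator_eq_bot_iff_le_centralizer]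
  by_cases hrq : r = q
  · subst hrq
    have h1 := hR.le_of_isPGroup (hn r R hR) hQ.le hQ.isPGroup
    have h2 : ⁅R, R⁆ = ⊥ := by
      by_contra h2
      exact hab r ‹_› R hR h2 (hn r R hR)
    exact le_bot_iff.1 (h2 ▸ Subgroup.commutator_mono le_rfl h1)
  · rw [eq_bot_iff, ← (IsPGroup.disjoint_of_ne r q hrq R Q hR.isPGroup hQ.isPGroup).eq_bot]
    refine le_inf ?_ ?_
    · rw [Subgroup.commutator_comm]
      exact Subgroup.le_normalizer_iff_commutator_le_right.1 (hQ.le.trans (hn r R hR))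
    · exact Subgroup.le_normalizer_iff_commutator_le_right.1 (hR.le.trans (hn q Q hQ))

end NilpotentComplement

section AbelianSubgroup

variable {G : Type} [Group G] [Finite G] {N K M L : Subgroup G} {a b : ℕ}

/-- If the large degree is the index of an abelian subgroup, then it is attained by all characters
acting nontrivially on the derived subgroup of a normal `p`-subgroup. -/
lemma finrank_ne_of_index_abelian {p : ℕ} [Fact p.Prime] (hD : DegreesIn G N {a, b})
    {P T : Subgroup G} [P.Normal] (hPN : P ≤ N) (hp : IsPGroup p P) (hT : ⁅T, T⁆ = ⊥)
    (hTb : T.index = b) {V : Type} [AddCommGroup V] [Module ℂ V] [FiniteDimensional ℂ V]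
    {ρ : Representation ℂ G V} (hρ : IsIrr ρ) (hρP : Acts ρ ⁅P, P⁆) :
    Module.finrank ℂ V ≠ a := by
  intro hV
  have hPP : ⁅P, P⁆ ≠ ⊥ := by
    obtain ⟨x, hx, hx1⟩ := hρP
    intro h
    rw [h, Subgroup.mem_bot] at hx
    exact hx1 (by rw [hx, map_one])
  obtain ⟨d, h1, ⟨W, _, _, _, ψ, hψ, hψP, h2⟩, h3, j, rfl⟩ :=
    dvd_card_of_sylow P (fun h => hPP (by rw [h, Subgroup.commutator_bot_left])) hp
  have ha := hV ▸ h1 V ρ hρ hρP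
  rcases hD W ψ hψ (hψP.mono hPN) with hW | hW
  · exact h2 (hW ▸ ha)
  rw [Set.mem_singleton_iff] at hW
  obtain ⟨A, hA⟩ := exists_isSylowOf p T
  have h4 := h3 A hA.isPGroup fun h =>
    hPP (le_bot_iff.1 (hT ▸ Subgroup.commutator_mono (h.trans hA.le) (h.trans hA.le)))
  have h5 : Nat.card G = A.relIndex T * b * Nat.card A := by
    rw [← Subgroup.card_mul_index A, ← Subgroup.relIndex_mul_index hA.le, hTb, mul_comm]
  rw [h5] at h4
  have h6 := Nat.dvd_of_mul_dvd_mul_right Nat.card_pos h4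
  rw [hW] at h2
  refine h2 (Nat.Coprime.dvd_of_dvd_mul_left ?_ h6)
  rw [← pow_succ']
  exact Nat.Coprime.pow_left _ ((Nat.Prime.coprime_iff_not_dvd Fact.out).2 hA.not_dvd)

/-- A version of `finrank_ne_of_index_abelian` modulo a normal subgroup. -/
lemma finrank_ne_of_index_abelian_mod [M.Normal] {p : ℕ} [Fact p.Prime]
    (hD : DegreesIn G N {a, b}) {P T : Subgroup G} [(M ⊔ P).Normal] (hPN : P ≤ N)
    (hp : IsPGroup p P) (hT : ⁅T, T⁆ ≤ M) (hMT : M ≤ T) (hTb : T.index = b)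
    {V : Type} [AddCommGroup V] [Module ℂ V] [FiniteDimensional ℂ V]
    {ρ : Representation ℂ G V} (hρ : IsIrr ρ) (hρM : ¬ Acts ρ M) (hρP : Acts ρ ⁅P, P⁆) :
    Module.finrank ℂ V ≠ a := by
  let π := QuotientGroup.mk' M
  have hπ : Function.Surjective π := QuotientGroup.mk'_surjective M
  let ψ : Representation ℂ (G ⧸ M) V := QuotientGroup.lift M ρ (not_acts_iff_le.1 hρM)
  have hψ : IsIrr ψ := ⟨hρ.1, fun W hW => hρ.2 W fun g w hw => hW (π g) w hw⟩
  have hP : P.map π = (M ⊔ P).map π := by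
    rw [Subgroup.map_sup, QuotientGroup.map_mk'_self, bot_sup_eq]
  have : (P.map π).Normal := by
    rw [hP]
    exact Subgroup.Normal.map ‹_› π hπ
  refine finrank_ne_of_index_abelian (T := T.map π) (hD.map_mk M) (Subgroup.map_mono hPN)
    (hp.map π) ?_ ?_ hψ ?_
  · rwa [← Subgroup.map_commutator, Subgroup.map_eq_bot_iff, QuotientGroup.ker_mk']
  · rw [← hTb]
    exact Subgroup.index_map_eq T hπ (by rwa [QuotientGroup.ker_mk'])
  · obtain ⟨x, hx, hx1⟩ := hρP
    rw [← Subgroup.map_commutator]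
    exact ⟨π x, ⟨x, hx, rfl⟩, hx1⟩

theorem isPGroup_of_minimal {p : ℕ} [Fact p.Prime] [N.Normal] [K.Normal] [M.Normal]
    (hD : DegreesIn G N {a, b}) (hab : a < b) (hNK : ⁅N, N⁆ = K) (hKK : ⁅K, K⁆ = M)
    (hMM : ⁅M, M⁆ = ⊥) (hM : M ≠ ⊥) (hp : IsPGroup p M)
    (hmin : ∀ X : Subgroup G, X.Normal → X ≤ N → X ≠ ⊥ → M ≤ X) : IsPGroup p K := by
  by_contra hK
  have hKN : K ≤ N := hNK ▸ Subgroup.commutator_le_self N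
  have hMK : M ≤ K := hKK ▸ Subgroup.commutator_le_self K
  have hMN := hMK.trans hKN
  obtain ⟨L, hML, hML', hMN'⟩ := exists_complement hKN hKK hMM hM hp hmin hK
  have hKL := commutator_inf_eq_bot hD hab hKN hKK hMM hM hmin hML hML' hMN'
  set N₀ := N ⊓ L with hN₀
  have hN₀K : ⁅N₀, N₀⁆ ≤ K ⊓ L := le_inf
    ((Subgroup.commutator_mono inf_le_left inf_le_left).trans hNK.le)
    ((Subgroup.commutator_mono inf_le_right inf_le_right).trans (Subgroup.commutator_le_self _))
  have hN : N ≤ M ⊔ N₀ := fun n hn => by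
    obtain ⟨m, hm, l, hl, rfl⟩ := Subgroup.mem_sup_of_normal_left.1 (hML ▸ Subgroup.mem_top n)
    exact Subgroup.mul_mem_sup hm ⟨(Subgroup.mul_mem_cancel_left _ (hMN hm)).1 hn, hl⟩
  have hnab : ⁅N₀, N₀⁆ ≠ ⊥ := by
    intro h
    have h1 : ⁅N₀, N⁆ ≤ M := by
      rw [Subgroup.commutator_comm]
      exact (Subgroup.commutator_mono hN le_rfl).trans
        (sup_commutator_le (Subgroup.commutator_le_left _ _) (h.le.trans bot_le))
    have h2 : K ≤ M := hNK ▸ (Subgroup.commutator_mono hN le_rfl).trans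
      (sup_commutator_le (Subgroup.commutator_le_left _ _) h1)
    exact hM (le_bot_iff.1 (hKK.ge.trans ((Subgroup.commutator_mono h2 h2).trans hMM.le)))
  obtain ⟨r, hr, R, hR, hRR, hRn⟩ := exists_isSylowOf_commutator_ne_bot
    (le_bot_iff.1 (hKL ▸ Subgroup.commutator_mono hN₀K le_rfl)) hnab
  have hLN₀ : L ≤ Subgroup.normalizer (N₀ : Set G) :=
    (le_inf Subgroup.le_normalizer_of_normal Subgroup.le_normalizer).trans
      Subgroup.inf_normalizer_le_normalizer_inf
  have hLR : L ≤ Subgroup.normalizer (R : Set G) := by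
    have h1 : ∀ g ∈ L, R.map (MulAut.conj g).toMonoidHom ≤ R := fun g hg => by
      refine hR.le_of_isPGroup hRn ?_ (hR.isPGroup.map _)
      exact (Subgroup.map_mono hR.le).trans
        (Subgroup.mem_normalizer_iff_map_conj_eq.1 (hLN₀ hg)).le
    refine Subgroup.le_normalizer_iff_commutator_le_right.2 (Subgroup.commutator_le.2 ?_)
    intro g hg x hx
    rw [commutatorElement_def]
    exact R.mul_mem (h1 g hg ⟨x, hx, rfl⟩) (R.inv_mem hx)
  have hRN : R ≤ N := hR.le.trans inf_le_left
  have hRL : R ≤ L := hR.le.trans inf_le_right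
  have hMnorm : ∀ X : Subgroup G, L ≤ Subgroup.normalizer (X : Set G) → (M ⊔ X).Normal := by
    intro X hX
    refine normal_of_le_normalizer hML (le_sup_left.trans Subgroup.le_normalizer) ?_
    refine le_trans (le_inf ?_ hX) (Subgroup.normalizer_inf_normalizer_le_normalizer_sup M X)
    exact Subgroup.le_normalizer_of_normal
  have := hMnorm R hLR
  have hLR' := le_normalizer_commutator hLR hLR
  have := hMnorm _ hLR'
  have hRR0 : ⁅(⁅R, R⁆ : Subgroup G), ⁅R, R⁆⁆ = ⊥ := by
    refine le_bot_iff.1 (hKL ▸ Subgroup.commutator_mono ?_ ?_)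
    · exact (Subgroup.commutator_mono hR.le hR.le).trans hN₀K
    · exact (Subgroup.commutator_le_self R).trans hR.le
  obtain ⟨θ, hθ, hRθ⟩ : ∃ θ : M →* ℂˣ, θ ≠ 1 ∧ ¬ ⁅R, R⁆ ≤ inertia M (charRep θ) := by
    by_contra! h
    exact hRR (eq_bot_of_commutator_eq_bot hM hmin hML hML'
      ((Subgroup.commutator_le_self R).trans hRN) ((Subgroup.commutator_le_self R).trans hRL)
      hLR' (commutator_eq_bot_of_le_inertia hMM h))
  obtain ⟨hTb, hTM⟩ := index_inertia_of_complement hD hab hML hML' hMN' hθ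
  set T := inertia M (charRep θ) with hTdef
  have hMT : M ≤ T := le_inertia _
  obtain ⟨y, hy, hyT⟩ := SetLike.not_le_iff_exists.1 hRθ
  have hX : ⁅M ⊔ ⁅R, R⁆, M ⊔ ⁅R, R⁆⁆ ≤ T := by
    refine (sup_commutator_le (X := M) (Subgroup.commutator_le_left _ _) ?_).trans hMT
    rw [Subgroup.commutator_comm]
    exact sup_commutator_le (Subgroup.commutator_le_left _ _) (hRR0.le.trans bot_le)
  obtain ⟨μ, hμ, hμy⟩ := exists_hom_ne_one hX ⟨y, le_sup_right (a := M) hy⟩ hyT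
  obtain ⟨V, _, _, _, ρ, hρ, hV, hlt⟩ := exists_irr_hasWeight_finrank_lt T _ μ
    (fun h => hμy (by rw [h]; rfl)) hμ
  have hVa : Module.finrank ℂ V = a := by
    rcases hD V ρ hρ ((hV.acts hμy).mono
      (sup_le hMN ((Subgroup.commutator_le_self R).trans hRN))) with h | h
    · exact h
    · rw [Set.mem_singleton_iff] at h
      omega
  obtain ⟨v, hv0, hv⟩ := hV
  refine finrank_ne_of_index_abelian_mod hD hRN hR.isPGroup hTM hMT hTb hρ ?_ ?_ hVa
  · refine hρ.eq_one_of_fixed M hv0 fun m hm => ?_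
    rw [hv ⟨m, le_sup_left (a := M) hm⟩, hμ _ (hMT hm), Units.val_one, one_smul]
  · refine ⟨y, hy, fun h => hμy ?_⟩
    have h1 := hv ⟨y, le_sup_right (a := M) hy⟩
    rw [h, Module.End.one_apply] at h1
    have h2 : ((1 : ℂ) - (μ ⟨y, le_sup_right (a := M) hy⟩ : ℂ)) • v = 0 := by
      rw [sub_smul, one_smul, ← h1, sub_self]
    rw [smul_eq_zero, or_iff_left hv0, sub_eq_zero] at h2
    exact Units.ext h2.symm

end AbelianSubgroup

section Metabelian

/-- An abelian minimal normal subgroup is a `p`-group. -/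
lemma exists_isPGroup_of_minimal {G : Type} [Group G] [Finite G] {M : Subgroup G} [M.Normal]
    (hMM : ⁅M, M⁆ = ⊥) (hM : M ≠ ⊥)
    (hmin : ∀ X : Subgroup G, X.Normal → X ≤ M → X ≠ ⊥ → M ≤ X) :
    ∃ (p : ℕ) (_ : Fact p.Prime), IsPGroup p M := by
  have : Nontrivial M := (Subgroup.nontrivial_iff_ne_bot M).2 hM
  obtain ⟨p, hp, hd⟩ := Nat.exists_prime_and_dvd (n := Nat.card M) Finite.one_lt_card.ne'
  have := Fact.mk hp
  obtain ⟨P, hP⟩ := exists_isSylowOf p M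
  have hPM : P.Normal := by
    have h1 := hP.sup_normal (X := ⊥) (by
      rw [bot_sup_eq]
      exact le_normalizer_of_commutator_eq_bot
        (le_bot_iff.1 (hMM ▸ Subgroup.commutator_mono le_rfl hP.le)))
    rwa [bot_sup_eq] at h1
  refine ⟨p, ‹_›, hP.isPGroup.to_le (hmin P hPM hP.le ?_)⟩
  rintro rfl
  have h1 := hP.not_dvd
  rw [Subgroup.relIndex_bot_left] at h1
  exact h1 hd

theorem commutator_commutator_eq_bot (n : ℕ) : ∀ (G : Type) [Group G] [Finite G],
    Nat.card G = n → ∀ (N : Subgroup G) [N.Normal], Group.IsSolvable N → ∀ {a b : ℕ}, a < b →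
      DegreesIn G N {a, b} → ⁅⁅N, N⁆, ⁅N, N⁆⁆ = ⊥ := by
  induction n using Nat.strong_induction_on with
  | _ n ih =>
  intro G _ _ hG N _ hsol a b hab hD
  by_contra hM
  have hKN : ⁅N, N⁆ ≤ N := Subgroup.commutator_le_self N
  have hMK : ⁅⁅N, N⁆, ⁅N, N⁆⁆ ≤ ⁅N, N⁆ := Subgroup.commutator_le_self ⁅N, N⁆
  have hmin : ∀ X : Subgroup G, X.Normal → X ≤ N → X ≠ ⊥ → ⁅⁅N, N⁆, ⁅N, N⁆⁆ ≤ X := by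
    intro X hX hXN hX0
    have hπ := QuotientGroup.mk'_surjective X
    have hN : (N.map (QuotientGroup.mk' X)).Normal := Subgroup.Normal.map ‹_› _ hπ
    have h1 := ih (Nat.card (G ⧸ X)) ?_ (G ⧸ X) rfl (N.map (QuotientGroup.mk' X))
      (Group.isSolvable_of_surjective ((QuotientGroup.mk' X).subgroupMap_surjective N)) hab (hD.map_mk X)
    · rwa [← Subgroup.map_commutator, ← Subgroup.map_commutator, Subgroup.map_eq_bot_iff,
        QuotientGroup.ker_mk'] at h1
    · rw [← hG, ← Subgroup.card_mul_index X, ← Subgroup.index_eq_card]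
      have h2 : 1 < Nat.card X := (Subgroup.one_lt_card_iff_ne_bot X).2 hX0
      have h3 : 0 < X.index := Nat.pos_of_ne_zero Subgroup.index_ne_zero_of_finite
      nlinarith
  generalize hK : ⁅N, N⁆ = K at *
  generalize hMdef : ⁅K, K⁆ = M at *
  have : K.Normal := hK ▸ inferInstance
  have : M.Normal := hMdef ▸ inferInstance
  have hMM : ⁅M, M⁆ = ⊥ := by
    by_contra h
    have hsolM : Group.IsSolvable M :=
      Group.isSolvable_of_isSolvable_injective (Subgroup.inclusion_injective (hMK.trans hKN))
    have hnt : Nontrivial M := (Subgroup.nontrivial_iff_ne_bot M).2 hM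
    refine (Group.IsSolvable.commutator_lt_top_of_nontrivial M).not_ge ?_
    rw [← Subgroup.map_subtype_le_map_subtype, Subgroup.map_subtype_commutator]
    exact (Subgroup.map_subtype_le _).trans (hmin _ inferInstance
      ((Subgroup.commutator_le_self M).trans (hMK.trans hKN)) h)
  obtain ⟨p, _, hp⟩ := exists_isPGroup_of_minimal hMM hM
    fun X hX hXM => hmin X hX (hXM.trans (hMK.trans hKN))
  have hKp := isPGroup_of_minimal hD hab hK hMdef hMM hM hp hmin
  subst hK
  exact hM (hMdef ▸ commutator_eq_bot_of_isPGroup_commutator hKp hD hab)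

lemma derivedSeries_two_eq_bot_iff {G : Type} [Group G] (N : Subgroup G) :
    derivedSeries N 2 = ⊥ ↔ ⁅⁅N, N⁆, ⁅N, N⁆⁆ = ⊥ := by
  rw [← Subgroup.map_eq_bot_iff_of_injective _ N.subtype_injective]
  simp only [derivedSeries_succ, derivedSeries_zero, Subgroup.map_commutator]
  rw [← MonoidHom.range_eq_map, Subgroup.range_subtype]

end Metabelian

end CRep

/-- **Theorem 5.3.** Let `N ⊴ G` be solvable with `|cd(G|N)| = 2`.  Then the derived
length of `N` is at most `2`, i.e. `N` is metabelian. -/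
theorem stmt12 (G : Type) [Group G] [Fintype G] (N : Subgroup G) [N.Normal]
    (hsol : IsSolvable ↥N) (h : (cdOver G N).ncard = 2) :
    derivedSeries ↥N 2 = ⊥ := by
  obtain ⟨a, b, hab, hcd⟩ := Set.ncard_eq_two.1 h
  have hD := CRep.degreesIn_cdOver N
  rw [CRep.derivedSeries_two_eq_bot_iff]
  rcases lt_or_gt_of_ne hab with hlt | hlt
  · exact CRep.commutator_commutator_eq_bot _ G rfl N hsol hlt (hcd ▸ hD)
  · exact CRep.commutator_commutator_eq_bot _ G rfl N hsol hlt (Set.pair_comm a b ▸ hcd ▸ hD)
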